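/- arXiv:2303.00151 — 2 statements merged into one kernel-verified Lean document; each statement's English description precedes it below -/
import Mathlib

section
/- Suppose the linear system y' = A(t)y admits an exponential trichotomy with fundamental matrix U, projections P, Q and constants β ≥ 1, α > 0, and suppose f : ℝ × ℝⁿ → ℝⁿ is continuous and satisfies |f(t,x)| ≤ μ for all (t,x), |f(t,x₁) − f(t,x₂)| ≤ γ|x₁ − x₂| for all t, x₁, x₂, and 3βγα⁻¹ < 1. Then the nonlinear system x' = A(t)x + f(t,x) is topologically conjugated to the linear system y' = A(t)y. -/
open MeasureTheory Real

noncomputable section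

/-- `ℝⁿ` with the Euclidean norm. -/
abbrev Euc (n : ℕ) : Type := EuclideanSpace ℝ (Fin n)

/-- Bounded linear operators on `ℝⁿ`, playing the role of `n × n` real matrices. -/
abbrev Op (n : ℕ) : Type := Euc n →L[ℝ] Euc n

/-- `U` is a fundamental matrix of the linear system `y' = A(t) y`, with pointwise
inverse `Uinv`. -/
def IsFundamental {n : ℕ} (A U Uinv : ℝ → Op n) : Prop :=
  (∀ t, HasDerivAt U ((A t).comp (U t)) t) ∧
  (∀ t, (U t).comp (Uinv t) = 1) ∧ (∀ t, (Uinv t).comp (U t) = 1)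

/-- The linear system with fundamental matrix `U` (with inverse `Uinv`) admits an
exponential trichotomy with projections `P`, `Q` and constants `β ≥ 1`, `α > 0`. -/
def ExpTrichotomy {n : ℕ} (U Uinv : ℝ → Op n) (P Q : Op n) (β α : ℝ) : Prop :=
  P.comp P = P ∧ Q.comp Q = Q ∧ P.comp Q = Q.comp P ∧
  P + Q - P.comp Q = 1 ∧ 1 ≤ β ∧ 0 < α ∧
  (∀ s t : ℝ, 0 ≤ s → s ≤ t →
    ‖(U t).comp (P.comp (Uinv s))‖ ≤ β * Real.exp (-α * (t - s))) ∧
  (∀ s t : ℝ, t ≤ s → 0 ≤ s →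
    ‖(U t).comp ((1 - P).comp (Uinv s))‖ ≤ β * Real.exp (-α * (s - t))) ∧
  (∀ s t : ℝ, t ≤ s → s ≤ 0 →
    ‖(U t).comp (Q.comp (Uinv s))‖ ≤ β * Real.exp (-α * (s - t))) ∧
  (∀ s t : ℝ, s ≤ t → s ≤ 0 →
    ‖(U t).comp ((1 - Q).comp (Uinv s))‖ ≤ β * Real.exp (-α * (t - s)))

/-- `y` is a solution of the linear system `y' = A(t) y`. -/
def IsLinSol {n : ℕ} (A : ℝ → Op n) (y : ℝ → Euc n) : Prop :=
  ∀ t, HasDerivAt y (A t (y t)) t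

/-- `x` is a solution of the nonlinear system `x' = A(t) x + f(t, x)`. -/
def IsNonlinSol {n : ℕ} (A : ℝ → Op n) (f : ℝ → Euc n → Euc n) (x : ℝ → Euc n) : Prop :=
  ∀ t, HasDerivAt x (A t (x t) + f t (x t)) t

/-- The pair `(H, L)` realizes a topological conjugacy between the nonlinear system
`x' = A(t)x + f(t,x)` and the linear system `y' = A(t)y`:  for each `t`, `H(t,·)` is a
homeomorphism of `ℝⁿ` with inverse `L(t,·)`; both differ boundedly from the identity;
`H` maps solutions of the nonlinear system to solutions of the linear system and `L`
maps solutions of the linear system to solutions of the nonlinear system. -/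
def ConjPair {n : ℕ} (A : ℝ → Op n) (f : ℝ → Euc n → Euc n)
    (H L : ℝ → Euc n → Euc n) : Prop :=
  (∀ t, Continuous (H t)) ∧ (∀ t, Continuous (L t)) ∧
  (∀ t x, L t (H t x) = x) ∧ (∀ t y, H t (L t y) = y) ∧
  (∃ C, ∀ t x, ‖H t x - x‖ ≤ C) ∧ (∃ C, ∀ t y, ‖L t y - y‖ ≤ C) ∧
  (∀ x : ℝ → Euc n, IsNonlinSol A f x → IsLinSol A (fun t => H t (x t))) ∧
  (∀ y : ℝ → Euc n, IsLinSol A y → IsNonlinSol A f (fun t => L t (y t)))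

/-- The Green function of an exponential trichotomy. -/
noncomputable def greenG {n : ℕ} (U Uinv : ℝ → Op n) (P Q : Op n) (t s : ℝ) : Op n :=
  if 0 ≤ s then
    (if s ≤ t then (U t).comp (P.comp (Uinv s))
     else -((U t).comp ((1 - P).comp (Uinv s))))
  else
    (if t ≤ s then -((U t).comp (Q.comp (Uinv s)))
     else (U t).comp ((1 - Q).comp (Uinv s)))

/-- The Green function `G̃` associated with the decomposition `P = P₁ + P₂ + P₃`,
`Q = P₂ + P₃ + P₄` (here `P₂₃ = P₂ + P₃`): its integral against a function realizes
`∫_{-∞}^t U(t)P₁U(s)⁻¹ · ds + ∫_0^t U(t)(P₂+P₃)U(s)⁻¹ · ds − ∫_t^∞ U(t)P₄U(s)⁻¹ · ds`. -/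
noncomputable def greenGt {n : ℕ} (U Uinv : ℝ → Op n) (P₁ P₂₃ P₄ : Op n)
    (t s : ℝ) : Op n :=
  (if s ≤ t then (U t).comp (P₁.comp (Uinv s)) else 0)
  + (if 0 ≤ s ∧ s ≤ t then (U t).comp (P₂₃.comp (Uinv s))
     else if t ≤ s ∧ s ≤ 0 then -((U t).comp (P₂₃.comp (Uinv s))) else 0)
  - (if t ≤ s then (U t).comp (P₄.comp (Uinv s)) else 0)


open Set Filter Topology

lemma gron_fwd {E : Type*} [NormedAddCommGroup E] [NormedSpace ℝ E] (v : ℝ → E → E) (K : NNReal)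
    (hv : ∀ t, LipschitzWith K (v t)) (x y : ℝ → E)
    (hx : ∀ t, HasDerivAt x (v t (x t)) t) (hy : ∀ t, HasDerivAt y (v t (y t)) t)
    (t s : ℝ) (hts : t ≤ s) : dist (x s) (y s) ≤ dist (x t) (y t) * exp (K * (s - t)) := by
  refine dist_le_of_trajectories_ODE (a := t) (b := s) hv ?_ ?_ ?_ ?_ le_rfl s ⟨hts, le_rfl⟩
  · exact fun r _ => (hx r).continuousAt.continuousWithinAt
  · exact fun r _ => (hx r).hasDerivWithinAt
  · exact fun r _ => (hy r).continuousAt.continuousWithinAt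
  · exact fun r _ => (hy r).hasDerivWithinAt

lemma gron_abs {E : Type*} [NormedAddCommGroup E] [NormedSpace ℝ E] (v : ℝ → E → E) (K : NNReal)
    (hv : ∀ t, LipschitzWith K (v t)) (x y : ℝ → E)
    (hx : ∀ t, HasDerivAt x (v t (x t)) t) (hy : ∀ t, HasDerivAt y (v t (y t)) t)
    (t s : ℝ) : dist (x s) (y s) ≤ dist (x t) (y t) * exp (K * |s - t|) := by
  rcases le_total t s with h | h
  · rw [abs_of_nonneg (by linarith)]
    exact gron_fwd v K hv x y hx hy t s h
  · rw [abs_of_nonpos (by linarith)]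
    have key : ∀ z : ℝ → E, (∀ t, HasDerivAt z (v t (z t)) t) →
        ∀ t, HasDerivAt (fun r => z (-r)) (-(v (-t) (z (-t)))) t := by
      intro z hz r
      have := (hz (-r)).scomp r (hasDerivAt_neg r)
      simpa [Function.comp_def] using this
    have := gron_fwd (fun r z => -(v (-r) z)) K (fun r => (hv (-r)).neg)
      (fun r => x (-r)) (fun r => y (-r)) (key x hx) (key y hy) (-t) (-s) (by linarith)
    simpa [add_comm, sub_eq_add_neg] using this

lemma ode_glue {E : Type*} [NormedAddCommGroup E] [NormedSpace ℝ E] (v : ℝ → E → E) (K : NNReal)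
    (hv : ∀ t, LipschitzWith K (v t)) (t₀ : ℝ) (x₀ : E)
    (h : ∀ R : ℝ, 0 < R → ∃ x : ℝ → E, x t₀ = x₀ ∧
      ∀ t ∈ Ioo (t₀ - R) (t₀ + R), HasDerivAt x (v t (x t)) t) :
    ∃ x : ℝ → E, x t₀ = x₀ ∧ ∀ t, HasDerivAt x (v t (x t)) t := by
  choose! X hX0 hX using h
  have hcomp : ∀ R S : ℝ, 0 < R → R ≤ S → EqOn (X R) (X S) (Ioo (t₀ - R) (t₀ + R)) := by
    intro R S hR hRS
    refine ODE_solution_unique_of_mem_Ioo (v := v) (s := fun _ => univ) (K := K) (t₀ := t₀)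
      (fun t _ => (hv t).lipschitzOnWith) ⟨by linarith, by linarith⟩
      (fun t ht => ⟨hX R hR t ht, trivial⟩)
      (fun t ht => ⟨hX S (by linarith) t ⟨by linarith [ht.1], by linarith [ht.2]⟩, trivial⟩) ?_
    rw [hX0 R hR, hX0 S (by linarith)]
  refine ⟨fun t => X (|t - t₀| + 1) t, hX0 _ (by positivity), fun t => ?_⟩
  have hpos : 0 < |t - t₀| + 3 := by positivity
  have ab := abs_le.1 (le_refl |t - t₀|)
  have hev : (fun t => X (|t - t₀| + 1) t) =ᶠ[𝓝 t] X (|t - t₀| + 3) := by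
    filter_upwards [Ioo_mem_nhds (show t - 1 < t by linarith) (show t < t + 1 by linarith)]
      with r hr
    have h1 := abs_le.1 (le_refl |r - t₀|)
    refine hcomp (|r - t₀| + 1) (|t - t₀| + 3) (by positivity) ?_
      ⟨by linarith, by linarith⟩
    have : |r - t₀| ≤ |t - t₀| + 1 := abs_le.2 ⟨by linarith [hr.1], by linarith [hr.2]⟩
    linarith
  rw [hev.hasDerivAt_iff]
  have e := hev.self_of_nhds
  simp only at e
  show HasDerivAt (X (|t - t₀| + 3)) (v t (X (|t - t₀| + 1) t)) t
  rw [e]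
  exact hX _ hpos t ⟨by linarith, by linarith⟩

lemma Uinv_cont {n : ℕ} {A U Uinv : ℝ → Op n} (hf : IsFundamental A U Uinv) : Continuous Uinv := by
  obtain ⟨h1, h2, h3⟩ := hf
  have e : Uinv = fun t => Ring.inverse (U t) := by
    funext t
    exact (Ring.inverse_unit (⟨U t, Uinv t, h2 t, h3 t⟩ : (Op n)ˣ)).symm
  rw [e]
  refine continuous_iff_continuousAt.2 fun t => ?_
  let u : (Op n)ˣ := ⟨U t, Uinv t, h2 t, h3 t⟩
  have := NormedRing.inverse_continuousAt u
  exact ContinuousAt.comp (f := U) (g := Ring.inverse) this (h1 t).continuousAt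

lemma U_cont {n : ℕ} {A U Uinv : ℝ → Op n} (hf : IsFundamental A U Uinv) : Continuous U :=
  continuous_iff_continuousAt.2 fun t => (hf.1 t).continuousAt

lemma exp_abs_int {α : ℝ} (hα : 0 < α) (t : ℝ) :
    Integrable (fun s : ℝ => exp (-α * |t - s|)) ∧ ∫ s : ℝ, exp (-α * |t - s|) = 2 / α := by
  have h0 : Integrable (fun s : ℝ => exp (-α * |s|)) := by
    rw [← integrableOn_univ, ← Iic_union_Ioi (a := (0:ℝ))]
    refine IntegrableOn.union ?_ ?_
    · refine (integrableOn_exp_mul_Iic hα 0).congr_fun (fun x hx => ?_) measurableSet_Iic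
      simp only [abs_of_nonpos (mem_Iic.1 hx)]
      congr 1; ring
    · refine (integrableOn_exp_mul_Ioi (a := -α) (by linarith) 0).congr_fun (fun x hx => ?_)
        measurableSet_Ioi
      simp only [abs_of_pos (mem_Ioi.1 hx)]
  constructor
  · exact h0.comp_sub_left t
  · rw [integral_sub_left_eq_self (fun s => exp (-α * |s|)) volume t]
    rw [integral_comp_abs (f := fun s => exp (-α * s)), integral_exp_mul_Ioi (by linarith)]
    simp [div_eq_mul_inv]

def Cker {n : ℕ} (Uinv : ℝ → Op n) (P Q : Op n) (s : ℝ) : Op n :=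
  if 0 < s then -((1 - P).comp (Uinv s)) else (1 - Q).comp (Uinv s)

def Gker {n : ℕ} (U Uinv : ℝ → Op n) (P Q : Op n) (t s : ℝ) : Op n :=
  (U t).comp (Cker Uinv P Q s + (Ioc 0 t).indicator Uinv s - (Ioc t 0).indicator Uinv s)

def Zop {n : ℕ} (U Uinv : ℝ → Op n) (P Q : Op n) (φ : ℝ → Euc n) (t : ℝ) : Euc n :=
  U t ((∫ s, Cker Uinv P Q s (φ s)) + ∫ s in (0:ℝ)..t, Uinv s (φ s))

lemma Gker_bound {n : ℕ} {U Uinv : ℝ → Op n} {P Q : Op n} {β α : ℝ}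
    (h : ExpTrichotomy U Uinv P Q β α) (t s : ℝ) :
    ‖Gker U Uinv P Q t s‖ ≤ β * exp (-α * |t - s|) := by
  obtain ⟨-, -, -, -, -, -, h1, h2, h3, h4⟩ := h
  unfold Gker Cker
  by_cases hs : 0 < s
  · have i2 : s ∉ Ioc t 0 := fun h => by linarith [h.2]
    rw [if_pos hs, indicator_of_notMem i2]
    by_cases hst : s ≤ t
    · have i1 : s ∈ Ioc 0 t := ⟨hs, hst⟩
      rw [indicator_of_mem i1, abs_of_nonneg (by linarith)]
      convert h1 s t hs.le hst using 2
      ext x; simp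
    · have i1 : s ∉ Ioc 0 t := fun h => hst h.2
      push Not at hst
      rw [indicator_of_notMem i1, abs_of_neg (by linarith), neg_sub]
      refine le_of_eq_of_le ?_ (h2 s t hst.le hs.le)
      rw [← norm_neg]
      congr 1
      ext x; simp
  · have i1 : s ∉ Ioc 0 t := fun h => hs h.1
    rw [if_neg hs, indicator_of_notMem i1]
    push Not at hs
    by_cases hst : t < s
    · have i2 : s ∈ Ioc t 0 := ⟨hst, hs⟩
      rw [indicator_of_mem i2, abs_of_neg (by linarith), neg_sub]
      refine le_of_eq_of_le ?_ (h3 s t hst.le hs)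
      rw [← norm_neg]
      congr 1
      ext x; simp
    · have i2 : s ∉ Ioc t 0 := fun h => hst h.1
      push Not at hst
      rw [indicator_of_notMem i2, abs_of_nonneg (by linarith)]
      convert h4 s t hst hs using 2
      ext x; simp

lemma Cker_bound {n : ℕ} {A U Uinv : ℝ → Op n} {P Q : Op n} {β α : ℝ}
    (hf : IsFundamental A U Uinv)
    (h : ExpTrichotomy U Uinv P Q β α) (s : ℝ) :
    ‖Cker Uinv P Q s‖ ≤ ‖Uinv 0‖ * (β * exp (-α * |0 - s|)) := by
  have e : Cker Uinv P Q s = (Uinv 0).comp (Gker U Uinv P Q 0 s) := by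
    unfold Gker
    rw [← ContinuousLinearMap.comp_assoc, hf.2.2 0]
    simp
    rfl
  rw [e]
  exact (ContinuousLinearMap.opNorm_comp_le _ _).trans
    (mul_le_mul_of_nonneg_left (Gker_bound h 0 s) (norm_nonneg _))

lemma Cker_meas {n : ℕ} {Uinv : ℝ → Op n} {P Q : Op n} (hU : Continuous Uinv) {φ : ℝ → Euc n}
    (hφ : Continuous φ) : StronglyMeasurable (fun s => Cker Uinv P Q s (φ s)) := by
  have e : (fun s => Cker Uinv P Q s (φ s)) = fun s =>
      if 0 < s then -((1 - P) (Uinv s (φ s))) else (1 - Q) (Uinv s (φ s)) := by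
    funext s
    unfold Cker
    split_ifs <;> rfl
  rw [e]
  exact StronglyMeasurable.ite measurableSet_Ioi
    (Continuous.stronglyMeasurable (by fun_prop)) (Continuous.stronglyMeasurable (by fun_prop))

lemma Cker_int {n : ℕ} {A U Uinv : ℝ → Op n} {P Q : Op n} {β α : ℝ}
    (hf : IsFundamental A U Uinv) (h : ExpTrichotomy U Uinv P Q β α)
    {φ : ℝ → Euc n} (hφ : Continuous φ) {M : ℝ} (hM : ∀ s, ‖φ s‖ ≤ M) :
    Integrable (fun s => Cker Uinv P Q s (φ s)) := by
  have hα : 0 < α := h.2.2.2.2.2.1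
  refine Integrable.mono' ((((exp_abs_int hα 0).1.const_mul β).const_mul ‖Uinv 0‖).mul_const M)
    (Cker_meas (Uinv_cont hf) hφ).aestronglyMeasurable (ae_of_all _ fun s => ?_)
  refine (ContinuousLinearMap.le_opNorm _ _).trans ?_
  have := Cker_bound hf h s
  exact mul_le_mul this (hM s) (norm_nonneg _) ((norm_nonneg _).trans this)

lemma Zop_eq {n : ℕ} {A U Uinv : ℝ → Op n} {P Q : Op n} {β α : ℝ}
    (hf : IsFundamental A U Uinv) (h : ExpTrichotomy U Uinv P Q β α)
    {φ : ℝ → Euc n} (hφ : Continuous φ) {M : ℝ} (hM : ∀ s, ‖φ s‖ ≤ M) (t : ℝ) :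
    Zop U Uinv P Q φ t = ∫ s, Gker U Uinv P Q t s (φ s) := by
  have hc := Cker_int hf h hφ hM
  have hUi := Uinv_cont hf
  have hloc : ∀ a b : ℝ, Integrable ((Ioc a b).indicator fun s => Uinv s (φ s)) := by
    intro a b
    rw [integrable_indicator_iff measurableSet_Ioc]
    exact (Continuous.integrableOn_Icc (by fun_prop)).mono_set Ioc_subset_Icc_self
  have e : ∀ s, Gker U Uinv P Q t s (φ s) = U t (Cker Uinv P Q s (φ s) +
      ((Ioc 0 t).indicator (fun s => Uinv s (φ s)) s
      - (Ioc t 0).indicator (fun s => Uinv s (φ s)) s)) := by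
    intro s
    unfold Gker
    simp only [indicator]
    split_ifs <;> simp
    abel
  simp_rw [e]
  have h2 : Integrable (fun s => (Ioc 0 t).indicator (fun s => Uinv s (φ s)) s
      - (Ioc t 0).indicator (fun s => Uinv s (φ s)) s) := (hloc 0 t).sub (hloc t 0)
  have h3 : Integrable (fun s => Cker Uinv P Q s (φ s) +
      ((Ioc 0 t).indicator (fun s => Uinv s (φ s)) s
      - (Ioc t 0).indicator (fun s => Uinv s (φ s)) s)) := hc.add h2
  rw [ContinuousLinearMap.integral_comp_comm _ h3, integral_add hc h2,
    integral_sub (hloc 0 t) (hloc t 0), integral_indicator measurableSet_Ioc,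
    integral_indicator measurableSet_Ioc]
  rfl

lemma Zop_bound {n : ℕ} {A U Uinv : ℝ → Op n} {P Q : Op n} {β α : ℝ}
    (hf : IsFundamental A U Uinv) (h : ExpTrichotomy U Uinv P Q β α)
    {φ : ℝ → Euc n} (hφ : Continuous φ) {M : ℝ} (hM : ∀ s, ‖φ s‖ ≤ M) (t : ℝ) :
    ‖Zop U Uinv P Q φ t‖ ≤ 2 * β / α * M := by
  have hα : 0 < α := h.2.2.2.2.2.1
  rw [Zop_eq hf h hφ hM]
  have := norm_integral_le_of_norm_le (f := fun s => Gker U Uinv P Q t s (φ s))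
    (((exp_abs_int hα t).1.const_mul β).mul_const M) (ae_of_all _ fun s => by
    refine (ContinuousLinearMap.le_opNorm _ _).trans ?_
    have := Gker_bound h t s
    exact mul_le_mul this (hM s) (norm_nonneg _) ((norm_nonneg _).trans this))
  refine this.trans (le_of_eq ?_)
  rw [integral_mul_const, integral_const_mul, (exp_abs_int hα t).2]
  ring

lemma Zop_sub {n : ℕ} {A U Uinv : ℝ → Op n} {P Q : Op n} {β α : ℝ}
    (hf : IsFundamental A U Uinv) (h : ExpTrichotomy U Uinv P Q β α)
    {φ ψ : ℝ → Euc n} (hφ : Continuous φ) (hψ : Continuous ψ) {M : ℝ} (hM : ∀ s, ‖φ s‖ ≤ M)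
    (hN : ∀ s, ‖ψ s‖ ≤ M) (t : ℝ) :
    Zop U Uinv P Q (fun s => φ s - ψ s) t = Zop U Uinv P Q φ t - Zop U Uinv P Q ψ t := by
  have hUi := Uinv_cont hf
  unfold Zop
  simp only [map_sub]
  rw [integral_sub (Cker_int hf h hφ hM) (Cker_int hf h hψ hN),
    intervalIntegral.integral_sub (Continuous.intervalIntegrable (by fun_prop) _ _)
      (Continuous.intervalIntegrable (by fun_prop) _ _)]
  simp only [map_add, map_sub]
  abel

lemma Zop_deriv {n : ℕ} {A U Uinv : ℝ → Op n} {P Q : Op n}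
    (hf : IsFundamental A U Uinv) {φ : ℝ → Euc n} (hφ : Continuous φ) (t : ℝ) :
    HasDerivAt (Zop U Uinv P Q φ) (A t (Zop U Uinv P Q φ t) + φ t) t := by
  have hUi := Uinv_cont hf
  have hc : Continuous fun s => Uinv s (φ s) := by fun_prop
  have h1 := (hf.1 t).clm_apply
    ((intervalIntegral.integral_hasDerivAt_right (hc.intervalIntegrable 0 t)
      hc.stronglyMeasurable.stronglyMeasurableAtFilter hc.continuousAt).const_add
      (∫ s, Cker Uinv P Q s (φ s)))
  have : U t (Uinv t (φ t)) = φ t := by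
    have := congrArg (fun T : Op n => T (φ t)) (hf.2.1 t)
    simpa using this
  rw [this] at h1
  exact h1

lemma Zop_cont {n : ℕ} {A U Uinv : ℝ → Op n} {P Q : Op n} {β α : ℝ}
    (hf : IsFundamental A U Uinv) (h : ExpTrichotomy U Uinv P Q β α)
    {φ : Euc n → ℝ → Euc n} (hφ : Continuous fun p : Euc n × ℝ => φ p.1 p.2)
    {M : ℝ} (hM : ∀ x s, ‖φ x s‖ ≤ M) :
    Continuous (fun p : ℝ × Euc n => Zop U Uinv P Q (φ p.2) p.1) := by
  have hUi := Uinv_cont hf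
  have hU := U_cont hf
  have hα : 0 < α := h.2.2.2.2.2.1
  have c1 : Continuous fun x => ∫ s, Cker Uinv P Q s (φ x s) := by
    refine continuous_of_dominated
      (bound := fun s => ‖Uinv 0‖ * (β * exp (-α * |0 - s|)) * M) ?_ ?_ ?_ ?_
    · intro x
      exact (Cker_meas hUi (by fun_prop)).aestronglyMeasurable
    · intro x
      refine ae_of_all _ fun s => ?_
      refine (ContinuousLinearMap.le_opNorm _ _).trans ?_
      have := Cker_bound hf h s
      exact mul_le_mul this (hM x s) (norm_nonneg _) ((norm_nonneg _).trans this)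
    · exact (((exp_abs_int hα 0).1.const_mul β).const_mul ‖Uinv 0‖).mul_const M
    · refine ae_of_all _ fun s => ?_
      fun_prop
  have c2 : Continuous fun p : ℝ × Euc n => ∫ s in (0:ℝ)..p.1, Uinv s (φ p.2 s) := by
    apply intervalIntegral.continuous_parametric_intervalIntegral_of_continuous
      (f := fun (p : ℝ × Euc n) s => Uinv s (φ p.2 s)) _ continuous_fst
    show Continuous fun q : (ℝ × Euc n) × ℝ => Uinv q.2 (φ q.1.2 q.2)
    fun_prop
  unfold Zop
  exact (hU.comp continuous_fst).clm_apply ((c1.comp continuous_snd).add c2)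

lemma U_Uinv {n : ℕ} {A U Uinv : ℝ → Op n} (hf : IsFundamental A U Uinv) (t : ℝ) (x : Euc n) :
    U t (Uinv t x) = x := by
  have := congrArg (fun T : Op n => T x) (hf.2.1 t)
  simpa using this

lemma Uinv_U {n : ℕ} {A U Uinv : ℝ → Op n} (hf : IsFundamental A U Uinv) (t : ℝ) (x : Euc n) :
    Uinv t (U t x) = x := by
  have := congrArg (fun T : Op n => T x) (hf.2.2 t)
  simpa using this

lemma U_sol {n : ℕ} {A U Uinv : ℝ → Op n} (hf : IsFundamental A U Uinv) (η : Euc n) :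
    IsLinSol A (fun t => U t η) := by
  intro t
  have := (hf.1 t).clm_apply (hasDerivAt_const t η)
  simpa using this

lemma lin_lip {n : ℕ} {A : ℝ → Op n} (hAbound : ∃ C, ∀ t, ‖A t‖ ≤ C) :
    ∃ K : NNReal, ∀ t, LipschitzWith K (fun x => A t x) := by
  obtain ⟨C, hC⟩ := hAbound
  have hC0 : 0 ≤ C := (norm_nonneg _).trans (hC 0)
  exact ⟨⟨C, hC0⟩, fun t => (A t).lipschitz.weaken (by exact hC t)⟩

lemma lin_eq {n : ℕ} {A U Uinv : ℝ → Op n} (hf : IsFundamental A U Uinv)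
    (hAbound : ∃ C, ∀ t, ‖A t‖ ≤ C) {y : ℝ → Euc n} (hy : IsLinSol A y) (t s : ℝ) :
    y s = U s (Uinv t (y t)) := by
  obtain ⟨K, hK⟩ := lin_lip hAbound
  have := gron_abs (fun t x => A t x) K hK y _ hy (U_sol hf (Uinv t (y t))) t s
  simp only [U_Uinv hf, dist_self, zero_mul] at this
  exact dist_le_zero.1 this

lemma nonlin_lip {n : ℕ} {A : ℝ → Op n} {f : ℝ → Euc n → Euc n} {γ : ℝ}
    (hAbound : ∃ C, ∀ t, ‖A t‖ ≤ C) (hγ : 0 ≤ γ)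
    (hflip : ∀ t x₁ x₂, ‖f t x₁ - f t x₂‖ ≤ γ * ‖x₁ - x₂‖) :
    ∃ K : NNReal, ∀ t, LipschitzWith K (fun x => A t x + f t x) := by
  obtain ⟨K, hK⟩ := lin_lip hAbound
  refine ⟨K + ⟨γ, hγ⟩, fun t => (hK t).add (LipschitzWith.of_dist_le_mul fun x y => ?_)⟩
  rw [dist_eq_norm, dist_eq_norm]
  exact hflip t x y

lemma nonlin_exists {n : ℕ} {A U Uinv : ℝ → Op n} {f : ℝ → Euc n → Euc n} {μ γ : ℝ}
    (hf : IsFundamental A U Uinv)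
    (hAbound : ∃ C, ∀ t, ‖A t‖ ≤ C) (hγ : 0 ≤ γ)
    (hfc : Continuous fun p : ℝ × Euc n => f p.1 p.2)
    (hfb : ∀ t x, ‖f t x‖ ≤ μ)
    (hflip : ∀ t x₁ x₂, ‖f t x₁ - f t x₂‖ ≤ γ * ‖x₁ - x₂‖) (t₀ : ℝ) (x₀ : Euc n) :
    ∃ x : ℝ → Euc n, x t₀ = x₀ ∧ IsNonlinSol A f x := by
  obtain ⟨K, hK⟩ := nonlin_lip hAbound hγ hflip
  refine ode_glue (fun t x => A t x + f t x) K hK t₀ x₀ fun R hR => ?_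
  have hU := U_cont hf
  have hUi := Uinv_cont hf
  have hμ : 0 ≤ μ := (norm_nonneg _).trans (hfb 0 0)
  obtain ⟨B, hB⟩ := (isCompact_Icc (a := t₀ - R) (b := t₀ + R)).exists_bound_of_continuousOn
    hU.continuousOn
  obtain ⟨D, hD⟩ := (isCompact_Icc (a := t₀ - R) (b := t₀ + R)).exists_bound_of_continuousOn
    hUi.continuousOn
  have hmem : t₀ ∈ Icc (t₀ - R) (t₀ + R) := ⟨by linarith, by linarith⟩
  have hB0 : 0 ≤ B := (norm_nonneg _).trans (hB t₀ hmem)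
  have hD0 : 0 ≤ D := (norm_nonneg _).trans (hD t₀ hmem)
  have pl : IsPicardLindelof (fun t w => Uinv t (f t (U t w))) (tmin := t₀ - R) (tmax := t₀ + R)
      ⟨t₀, hmem⟩ (Uinv t₀ x₀) (⟨D * μ * R, by positivity⟩ : NNReal) 0
      (⟨D * μ, by positivity⟩ : NNReal) (⟨D * (γ * B), by positivity⟩ : NNReal) := by
    refine ⟨fun t ht => ?_, fun w _ => ?_, fun t ht w _ => ?_, ?_⟩
    · refine (LipschitzWith.of_dist_le_mul fun w z => ?_).lipschitzOnWith
      rw [dist_eq_norm, dist_eq_norm, ← map_sub]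
      show _ ≤ D * (γ * B) * ‖w - z‖
      calc _ ≤ ‖Uinv t‖ * ‖f t (U t w) - f t (U t z)‖ := ContinuousLinearMap.le_opNorm _ _
        _ ≤ D * (γ * (B * ‖w - z‖)) := by
            refine mul_le_mul (hD t ht) ((hflip _ _ _).trans ?_) (norm_nonneg _) hD0
            refine mul_le_mul_of_nonneg_left ?_ hγ
            rw [← map_sub]
            exact (ContinuousLinearMap.le_opNorm _ _).trans
              (mul_le_mul_of_nonneg_right (hB t ht) (norm_nonneg _))
        _ = _ := by ring
    · have : Continuous fun t => f t (U t w) :=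
        hfc.comp (continuous_id.prodMk (hU.clm_apply continuous_const))
      exact (hUi.clm_apply this).continuousOn
    · exact (ContinuousLinearMap.le_opNorm _ _).trans
        (mul_le_mul (hD t ht) (hfb _ _) (norm_nonneg _) hD0)
    · show D * μ * max (t₀ + R - t₀) (t₀ - (t₀ - R)) ≤ D * μ * R - 0
      simp
  obtain ⟨w, hw0, hw⟩ := pl.exists_eq_forall_mem_Icc_hasDerivWithinAt₀
  refine ⟨fun t => U t (w t), ?_, fun t ht => ?_⟩
  · have : w t₀ = Uinv t₀ x₀ := hw0
    simp only [this, U_Uinv hf]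
  · have h1 := (hw t (Ioo_subset_Icc_self ht)).hasDerivAt (Icc_mem_nhds ht.1 ht.2)
    have h2 := (hf.1 t).clm_apply h1
    rw [U_Uinv hf] at h2
    exact h2

/-- the contraction fixed point -/
lemma exists_l {n : ℕ} {A U Uinv : ℝ → Op n} {P Q : Op n} {β α μ γ : ℝ} {f : ℝ → Euc n → Euc n}
    (hf : IsFundamental A U Uinv) (h : ExpTrichotomy U Uinv P Q β α) (hγ : 0 ≤ γ)
    (hfc : Continuous fun p : ℝ × Euc n => f p.1 p.2)
    (hfb : ∀ t x, ‖f t x‖ ≤ μ)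
    (hflip : ∀ t x₁ x₂, ‖f t x₁ - f t x₂‖ ≤ γ * ‖x₁ - x₂‖)
    (hk : 2 * β / α * γ < 1) :
    ∃ l : ℝ → Euc n → Euc n, Continuous (fun p : ℝ × Euc n => l p.1 p.2) ∧
      (∀ t η, ‖l t η‖ ≤ 2 * β / α * μ) ∧
      ∀ t η, l t η = Zop U Uinv P Q (fun s => f s (U s η + l s η)) t := by
  have hU := U_cont hf
  have hα : 0 < α := h.2.2.2.2.2.1
  have hβ : 1 ≤ β := h.2.2.2.2.1
  have hk0 : 0 ≤ 2 * β / α * γ := by positivity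
  have cont : ∀ l : ℝ × Euc n → Euc n, Continuous l →
      Continuous fun p : Euc n × ℝ => f p.2 (U p.2 p.1 + l (p.2, p.1)) := by
    intro l hl
    refine hfc.comp (continuous_snd.prodMk ?_)
    exact ((hU.comp continuous_snd).clm_apply continuous_fst).add
      (hl.comp (continuous_snd.prodMk continuous_fst))
  have cont' : ∀ l : ℝ × Euc n → Euc n, Continuous l → ∀ η,
      Continuous fun s => f s (U s η + l (s, η)) := fun l hl η =>
    (cont l hl).comp (continuous_const.prodMk continuous_id)
  let T : BoundedContinuousFunction (ℝ × Euc n) (Euc n) →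
      BoundedContinuousFunction (ℝ × Euc n) (Euc n) := fun l =>
    BoundedContinuousFunction.ofNormedAddCommGroup
      (fun p => Zop U Uinv P Q (fun s => f s (U s p.2 + l (s, p.2))) p.1)
      (Zop_cont hf h (φ := fun η s => f s (U s η + l (s, η))) (cont l l.continuous)
        (fun η s => hfb _ _))
      (2 * β / α * μ)
      (fun p => Zop_bound hf h (cont' l l.continuous p.2) (fun s => hfb _ _) _)
  have hT : ∀ l p, T l p = Zop U Uinv P Q (fun s => f s (U s p.2 + l (s, p.2))) p.1 :=
    fun l p => rfl
  have hc : ContractingWith (⟨2 * β / α * γ, hk0⟩ : NNReal) T := by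
    refine ⟨by exact_mod_cast hk, LipschitzWith.of_dist_le_mul fun l m => ?_⟩
    show _ ≤ 2 * β / α * γ * dist l m
    rw [BoundedContinuousFunction.dist_le (by positivity)]
    intro p
    rw [dist_eq_norm, hT, hT, ← Zop_sub hf h (cont' l l.continuous p.2)
      (cont' m m.continuous p.2) (fun s => hfb _ _) (fun s => hfb _ _), mul_assoc]
    refine Zop_bound hf h ((cont' l l.continuous p.2).sub (cont' m m.continuous p.2))
      (fun s => (hflip _ _ _).trans ?_) _
    refine mul_le_mul_of_nonneg_left ?_ hγ
    rw [add_sub_add_left_eq_sub, ← dist_eq_norm]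
    exact BoundedContinuousFunction.dist_coe_le_dist _
  have fp := hc.fixedPoint_isFixedPt
  set l := hc.fixedPoint
  have e : ∀ t η, l (t, η) = Zop U Uinv P Q (fun s => f s (U s η + l (s, η))) t := by
    intro t η
    rw [← hT l (t, η), fp.eq]
  refine ⟨fun t η => l (t, η), l.continuous, fun t η => ?_, e⟩
  show ‖l (t, η)‖ ≤ _
  rw [e]
  exact Zop_bound hf h (cont' l l.continuous η) (fun s => hfb _ _) _

lemma fix_unique {n : ℕ} {A U Uinv : ℝ → Op n} {P Q : Op n} {β α μ γ : ℝ}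
    {f : ℝ → Euc n → Euc n}
    (hf : IsFundamental A U Uinv) (h : ExpTrichotomy U Uinv P Q β α) (hγ : 0 ≤ γ)
    (hfc : Continuous fun p : ℝ × Euc n => f p.1 p.2)
    (hfb : ∀ t x, ‖f t x‖ ≤ μ)
    (hflip : ∀ t x₁ x₂, ‖f t x₁ - f t x₂‖ ≤ γ * ‖x₁ - x₂‖)
    (hk : 2 * β / α * γ < 1) (y v w : ℝ → Euc n) (hy : Continuous y)
    (hv : Continuous v) (hw : Continuous w)
    (ev : ∀ t, v t = Zop U Uinv P Q (fun s => f s (y s + v s)) t)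
    (ew : ∀ t, w t = Zop U Uinv P Q (fun s => f s (y s + w s)) t) (t : ℝ) : v t = w t := by
  have hα : 0 < α := h.2.2.2.2.2.1
  have hβ : 1 ≤ β := h.2.2.2.2.1
  have hk0 : 0 ≤ 2 * β / α * γ := by positivity
  have cv : Continuous fun s => f s (y s + v s) := hfc.comp (continuous_id.prodMk (hy.add hv))
  have cw : Continuous fun s => f s (y s + w s) := hfc.comp (continuous_id.prodMk (hy.add hw))
  have step : ∀ M, (∀ t, ‖v t - w t‖ ≤ M) → ∀ t, ‖v t - w t‖ ≤ 2 * β / α * γ * M := by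
    intro M hM t
    rw [ev, ew, ← Zop_sub hf h cv cw (fun s => hfb _ _) (fun s => hfb _ _), mul_assoc]
    refine Zop_bound hf h (cv.sub cw) (fun s => (hflip _ _ _).trans ?_) _
    refine mul_le_mul_of_nonneg_left ?_ hγ
    rw [add_sub_add_left_eq_sub]
    exact hM s
  have base : ∀ t, ‖v t - w t‖ ≤ 2 * β / α * (μ + μ) := by
    intro t
    rw [ev, ew, ← Zop_sub hf h cv cw (fun s => hfb _ _) (fun s => hfb _ _)]
    exact Zop_bound hf h (cv.sub cw)
      (fun s => (norm_sub_le _ _).trans (add_le_add (hfb _ _) (hfb _ _))) _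
  have it : ∀ m : ℕ, ∀ t, ‖v t - w t‖ ≤ (2 * β / α * γ) ^ m * (2 * β / α * (μ + μ)) := by
    intro m
    induction m with
    | zero => simpa using base
    | succ m ih =>
      intro t
      refine (step _ ih t).trans (le_of_eq ?_)
      rw [pow_succ]; ring
  have lim := (tendsto_pow_atTop_nhds_zero_of_lt_one hk0 hk).mul_const (2 * β / α * (μ + μ))
  rw [zero_mul] at lim
  have := ge_of_tendsto' lim (fun m => it m t)
  exact sub_eq_zero.1 (norm_le_zero_iff.1 this)

lemma main_aux {n : ℕ} (A U Uinv : ℝ → Op n) (P Q : Op n)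
    (β α μ γ : ℝ) (f : ℝ → Euc n → Euc n)
    (hAbound : ∃ C, ∀ t, ‖A t‖ ≤ C)
    (hf : IsFundamental A U Uinv)
    (h : ExpTrichotomy U Uinv P Q β α) (hγ : 0 ≤ γ)
    (hfc : Continuous fun p : ℝ × Euc n => f p.1 p.2)
    (hfb : ∀ t x, ‖f t x‖ ≤ μ)
    (hflip : ∀ t x₁ x₂, ‖f t x₁ - f t x₂‖ ≤ γ * ‖x₁ - x₂‖)
    (hk : 2 * β / α * γ < 1) :
    ∃ H L : ℝ → Euc n → Euc n, ConjPair A f H L := by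
  have hU := U_cont hf
  have hα : 0 < α := h.2.2.2.2.2.1
  obtain ⟨K, hK⟩ := nonlin_lip hAbound hγ hflip
  have hXe := fun t x => nonlin_exists hf hAbound hγ hfc hfb hflip t x
  choose X hX0 hX using hXe
  have scont : ∀ x : ℝ → Euc n, IsNonlinSol A f x → Continuous x := fun x hx =>
    continuous_iff_continuousAt.2 fun t => (hx t).continuousAt
  have fcont : ∀ x : ℝ → Euc n, Continuous x → Continuous fun s => f s (x s) := fun x hx =>
    hfc.comp (continuous_id.prodMk hx)
  have uniq : ∀ x : ℝ → Euc n, IsNonlinSol A f x → ∀ t, X t (x t) = x := by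
    intro x hx t
    funext s
    have := gron_abs _ K hK _ x (hX t (x t)) hx t s
    rw [hX0, dist_self, zero_mul] at this
    exact dist_le_zero.1 this
  obtain ⟨l, hlc, hlb, hl⟩ := exists_l hf h hγ hfc hfb hflip hk
  have lcont : ∀ η, Continuous fun s => l s η := fun η =>
    hlc.comp (continuous_id.prodMk continuous_const)
  let Z : (ℝ → Euc n) → ℝ → Euc n := fun x => Zop U Uinv P Q (fun s => f s (x s))
  have hZd : ∀ x : ℝ → Euc n, Continuous x → ∀ t,
      HasDerivAt (Z x) (A t (Z x t) + f t (x t)) t := fun x hx t =>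
    Zop_deriv hf (fcont x hx) t
  have hZb : ∀ x : ℝ → Euc n, Continuous x → ∀ t, ‖Z x t‖ ≤ 2 * β / α * μ := fun x hx t =>
    Zop_bound hf h (fcont x hx) (fun s => hfb _ _) t
  -- the solution `U η + l η`
  have hW : ∀ η, IsNonlinSol A f (fun s => U s η + l s η) := by
    intro η t
    have c : Continuous fun s => U s η + l s η := (hU.clm_apply continuous_const).add (lcont η)
    have e : (fun s => l s η) = Z (fun s => U s η + l s η) := by
      funext s; exact hl s η
    have h1 := (U_sol hf η t).add (hZd _ c t)
    rw [← e] at h1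
    refine h1.congr_deriv ?_
    simp only [map_add]
    abel
  have hLin : ∀ x, IsNonlinSol A f x → IsLinSol A (fun t => x t - Z x t) := by
    intro x hx t
    have h1 := (hx t).sub (hZd x (scont x hx) t)
    refine h1.congr_deriv ?_
    simp only [map_sub]
    abel
  refine ⟨fun t x => x - Z (X t x) t, fun t y => y + l t (Uinv t y), ?_, ?_, ?_, ?_, ?_, ?_, ?_, ?_⟩
  · -- continuity of H
    intro t
    refine continuous_id.sub ?_
    have jc : Continuous fun p : Euc n × ℝ => X t p.1 p.2 := by
      refine continuous_iff_continuousAt.2 fun p => ?_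
      obtain ⟨x, s⟩ := p
      have h1 : Tendsto (fun p : Euc n × ℝ => dist x p.1 * exp (K * |p.2 - t|)
          + dist (X t x p.2) (X t x s)) (𝓝 (x, s)) (𝓝 0) := by
        have hc := scont _ (hX t x)
        have : Continuous fun p : Euc n × ℝ => dist x p.1 * exp (K * |p.2 - t|)
          + dist (X t x p.2) (X t x s) := by fun_prop
        have := this.tendsto (x, s)
        simpa using this
      refine tendsto_iff_dist_tendsto_zero.2 (squeeze_zero (fun _ => dist_nonneg) (fun p => ?_) h1)
      refine (dist_triangle _ (X t x p.2) _).trans (add_le_add_left ?_ _)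
      rw [dist_comm]
      have := gron_abs _ K hK _ _ (hX t x) (hX t p.1) t p.2
      rwa [hX0, hX0] at this
    have h2 := Zop_cont hf h (φ := fun x s => f s (X t x s))
      (hfc.comp (continuous_snd.prodMk jc)) (fun _ _ => hfb _ _)
    exact h2.comp (continuous_const.prodMk continuous_id)
  · intro t
    exact continuous_id.add (hlc.comp (continuous_const.prodMk (Uinv t).continuous))
  · -- L (H x) = x
    intro t x
    have hx := hX t x
    have hc := scont _ hx
    set η := Uinv t (X t x t - Z (X t x) t) with hη
    have e1 : ∀ s, X t x s - Z (X t x) s = U s η := fun s => lin_eq hf hAbound (hLin _ hx) t s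
    have zc : Continuous (Z (X t x)) :=
      continuous_iff_continuousAt.2 fun s => (hZd _ hc s).continuousAt
    have e2 := fix_unique hf h hγ hfc hfb hflip hk (fun s => U s η) (Z (X t x))
      (fun s => l s η) (hU.clm_apply continuous_const) zc (lcont η)
      (fun r => by
        have : (fun s => f s (U s η + Z (X t x) s)) = fun s => f s (X t x s) := by
          funext s; rw [← e1 s, sub_add_cancel]
        rw [this]) (fun r => hl r η) t
    rw [hX0] at hη
    show x - Z (X t x) t + l t (Uinv t (x - Z (X t x) t)) = x
    rw [← hη, ← e2, sub_add_cancel]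
  · -- H (L y) = y
    intro t y
    have e := uniq _ (hW (Uinv t y)) t
    simp only [U_Uinv hf] at e
    show y + l t (Uinv t y) - Z (X t (y + l t (Uinv t y))) t = y
    rw [e]
    show y + l t (Uinv t y) - Zop U Uinv P Q (fun s => f s (U s (Uinv t y) + l s (Uinv t y))) t = y
    rw [← hl, add_sub_cancel_right]
  · refine ⟨2 * β / α * μ, fun t x => ?_⟩
    rw [sub_sub_cancel_left, norm_neg]
    exact hZb _ (scont _ (hX t x)) t
  · refine ⟨2 * β / α * μ, fun t y => ?_⟩
    rw [add_sub_cancel_left]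
    exact hlb _ _
  · intro x hx
    have e : (fun t => x t - Z (X t (x t)) t) = fun t => x t - Z x t := by
      funext t; rw [uniq x hx t]
    show IsLinSol A (fun t => x t - Z (X t (x t)) t)
    rw [e]
    exact hLin x hx
  · intro y hy
    have e : (fun t => y t + l t (Uinv t (y t))) =
        fun t => U t (Uinv 0 (y 0)) + l t (Uinv 0 (y 0)) := by
      funext t
      have := lin_eq hf hAbound hy 0 t
      rw [this, Uinv_U hf]
    show IsNonlinSol A f (fun t => y t + l t (Uinv t (y t)))
    rw [e]
    exact hW _

/-- **Theorem 2.6 (Palmer-type linearization under exponential trichotomy).**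
If the linear system `y' = A(t)y` admits an exponential trichotomy and `f` is bounded
by `μ`, Lipschitz with constant `γ`, and `3βγα⁻¹ < 1`, then the nonlinear system
`x' = A(t)x + f(t,x)` is topologically conjugated to the linear system `y' = A(t)y`. -/
theorem linearization_expTrichotomy {n : ℕ} (A U Uinv : ℝ → Op n) (P Q : Op n)
    (β α μ γ : ℝ) (f : ℝ → Euc n → Euc n)
    (hA : Continuous A) (hAbound : ∃ C, ∀ t, ‖A t‖ ≤ C)
    (hfund : IsFundamental A U Uinv)
    (htri : ExpTrichotomy U Uinv P Q β α)
    (hfc : Continuous fun p : ℝ × Euc n => f p.1 p.2)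
    (hfb : ∀ t x, ‖f t x‖ ≤ μ)
    (hflip : ∀ t x₁ x₂, ‖f t x₁ - f t x₂‖ ≤ γ * ‖x₁ - x₂‖)
    (hsmall : 3 * β * γ * α⁻¹ < 1) :
    ∃ H L : ℝ → Euc n → Euc n, ConjPair A f H L := by
  have hα : 0 < α := htri.2.2.2.2.2.1
  have hβ : 1 ≤ β := htri.2.2.2.2.1
  refine main_aux A U Uinv P Q β α μ (max γ 0) f hAbound hfund htri (le_max_right _ _) hfc hfb
    (fun t x₁ x₂ => (hflip t x₁ x₂).trans
      (mul_le_mul_of_nonneg_right (le_max_left _ _) (norm_nonneg _))) ?_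
  rcases le_total γ 0 with hg | hg
  · rw [max_eq_right hg]; simp
  · rw [max_eq_left hg]
    have h1 : 2 * β / α * γ = 2 * (β * γ * α⁻¹) := by ring
    have h2 : 3 * β * γ * α⁻¹ = 3 * (β * γ * α⁻¹) := by ring
    have h3 : 0 ≤ β * γ * α⁻¹ := by positivity
    rw [h1]; rw [h2] at hsmall
    linarith
end
end

section
/- Suppose the linear system y' = A(t)y admits an exponential trichotomy with fundamental matrix U, projections P = P₁ + P₂ + P₃ and Q = P₂ + P₃ + P₄ and constants β ≥ 1, α > 0, where P₁, P₂, P₃, P₄ are mutually orthogonal projections such that ‖U(t)P₁U(s)⁻¹‖ ≤ κ₁ and ‖U(t)P₄U(s)⁻¹‖ ≤ κ₂ for all t, s ∈ ℝ. Suppose f : ℝ × ℝⁿ → ℝⁿ is continuous with |f(t,x)| ≤ φ(t) for all x, |f(t,x₁) − f(t,x₂)| ≤ ψ(t)|x₁ − x₂|, where φ, ψ : ℝ → [0,∞) are integrable with ∫_{−∞}^{∞} φ(t)dt < c₁, ∫_{−∞}^{∞} ψ(t)dt < c₂, and (β + 2κ₁ + κ₂)c₂ < 1. Then the nonlinear system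 x' = A(t)x + f(t,x) is topologically conjugated to the linear system y' = A(t)y (in particular f may be unbounded in t and need not be Lipschitz with a uniform constant). -/
open MeasureTheory Real

noncomputable section

theorem aux_kernel {E : Type*} [NormedAddCommGroup E] [NormedSpace ℝ E]
    {N c D τ t : ℝ} {r φ : ℝ → ℝ} {g : ℝ → E}
    (hN : 0 ≤ N) (hc : 0 < c) (hNc : 4 * N ≤ c) (hD : 0 ≤ D)
    (hr0 : ∀ s, 0 ≤ r s) (hφ0 : ∀ s, 0 ≤ φ s)
    (hr : Integrable r) (hφ : Integrable φ) (hr4 : (∫ s, r s) ≤ 1 / 4)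
    (hg : ∀ s ∈ Set.uIoc τ t, ‖g s‖ ≤ (N + r s) * (D * Real.cosh (c * (s - τ))) + φ s) :
    ‖∫ s in τ..t, g s‖ ≤ D / 2 * Real.cosh (c * (t - τ)) + ∫ s, φ s := by
  set w := Real.cosh (c * (t - τ)) with hw
  have hw0 : 0 < w := Real.cosh_pos _
  have hle : ∀ s ∈ Set.uIoc τ t,
      ‖g s‖ ≤ N * D * Real.cosh (c * (s - τ)) + (D * w * r s + φ s) := by
    intro s hs
    have h1 : Real.cosh (c * (s - τ)) ≤ w := by
      rw [hw, Real.cosh_le_cosh, abs_mul, abs_mul]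
      refine mul_le_mul_of_nonneg_left ?_ (abs_nonneg _)
      have := Set.abs_sub_left_of_mem_uIcc (Set.uIoc_subset_uIcc hs)
      simpa using this
    have h2 : r s * D * Real.cosh (c * (s - τ)) ≤ r s * D * w :=
      mul_le_mul_of_nonneg_left h1 (mul_nonneg (hr0 s) hD)
    have := hg s hs
    nlinarith
  have hi1 : IntervalIntegrable (fun s => N * D * Real.cosh (c * (s - τ))) volume τ t := by
    apply Continuous.intervalIntegrable; fun_prop
  have hI2 : Integrable (fun s => D * w * r s + φ s) := (hr.const_mul _).add hφ
  have hi2 : IntervalIntegrable (fun s => D * w * r s + φ s) volume τ t :=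
    hI2.intervalIntegrable
  have h0 := intervalIntegral.norm_integral_le_abs_of_norm_le (μ := volume)
    (f := g) (a := τ) (b := t)
    (g := fun s => N * D * Real.cosh (c * (s - τ)) + (D * w * r s + φ s))
    (by
      rw [ae_restrict_iff' measurableSet_uIoc]
      exact Filter.Eventually.of_forall hle) (hi1.add hi2)
  rw [intervalIntegral.integral_add hi1 hi2] at h0
  have hA : ∫ s in τ..t, N * D * Real.cosh (c * (s - τ))
      = N * D * (Real.sinh (c * (t - τ)) / c) := by
    rw [intervalIntegral.integral_const_mul]
    congr 1
    have := intervalIntegral.integral_eq_sub_of_hasDerivAt (a := τ) (b := t)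
      (f := fun s => Real.sinh (c * (s - τ)) / c)
      (f' := fun s => Real.cosh (c * (s - τ)))
      (by
        intro s _
        have h : HasDerivAt (fun s => c * (s - τ)) c s := by
          simpa using ((hasDerivAt_id s).sub_const τ).const_mul c
        have h' := (h.sinh).div_const c
        have e : Real.cosh (c * (s - τ)) * c / c = Real.cosh (c * (s - τ)) := by
          field_simp
        rwa [e] at h')
      (by apply Continuous.intervalIntegrable; fun_prop)
    simpa using this
  have hsinh : |Real.sinh (c * (t - τ))| ≤ w := by
    rw [abs_le]
    have h1 := Real.cosh_add_sinh (c * (t - τ))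
    have h2 := Real.cosh_sub_sinh (c * (t - τ))
    have h3 := Real.exp_pos (c * (t - τ))
    have h4 := Real.exp_pos (-(c * (t - τ)))
    constructor <;> linarith
  have hA' : |∫ s in τ..t, N * D * Real.cosh (c * (s - τ))| ≤ D / 4 * w := by
    rw [hA, abs_mul, abs_div, abs_of_nonneg (mul_nonneg hN hD), abs_of_pos hc]
    have : |Real.sinh (c * (t - τ))| / c ≤ w / c := by gcongr
    calc N * D * (|Real.sinh (c * (t - τ))| / c) ≤ N * D * (w / c) := by gcongr
      _ = (N / c) * (D * w) := by ring
      _ ≤ (1 / 4) * (D * w) := by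
        refine mul_le_mul_of_nonneg_right ?_ (mul_nonneg hD hw0.le)
        rw [div_le_div_iff₀ hc (by norm_num)]; linarith
      _ = _ := by ring
  have hB' : |∫ s in τ..t, (D * w * r s + φ s)| ≤ D / 4 * w + ∫ s, φ s := by
    have hnn : ∀ s, 0 ≤ D * w * r s + φ s := fun s =>
      add_nonneg (mul_nonneg (mul_nonneg hD hw0.le) (hr0 s)) (hφ0 s)
    rw [intervalIntegral.abs_intervalIntegral_eq,
      abs_of_nonneg (integral_nonneg hnn)]
    calc _ ≤ ∫ s, (D * w * r s + φ s) :=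
          setIntegral_le_integral hI2 (Filter.Eventually.of_forall hnn)
      _ = D * w * (∫ s, r s) + ∫ s, φ s := by
          rw [integral_add (hr.const_mul _) hφ, integral_const_mul]
      _ ≤ D * w * (1 / 4) + ∫ s, φ s := by gcongr
      _ = _ := by ring
  have := abs_add_le (∫ s in τ..t, N * D * Real.cosh (c * (s - τ)))
    (∫ s in τ..t, (D * w * r s + φ s))
  linarith

theorem aux_gronwall {E : Type*} [NormedAddCommGroup E] [NormedSpace ℝ E]
    {N c a τ : ℝ} {r : ℝ → ℝ} {x₁ x₂ : ℝ → E} {F : ℝ → E → E}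
    (hN : 0 ≤ N) (hc : 0 < c) (hNc : 4 * N ≤ c)
    (hr0 : ∀ s, 0 ≤ r s) (hr : Integrable r) (hr4 : (∫ s, r s) ≤ 1 / 4)
    (hL : ∀ t x y, ‖F t x - F t y‖ ≤ (N + r t) * ‖x - y‖)
    (hF : Continuous fun p : ℝ × E => F p.1 p.2)
    (hx₁ : Continuous x₁) (hx₂ : Continuous x₂)
    (h1 : ∀ t, x₁ t = x₁ τ + ∫ s in τ..t, F s (x₁ s))
    (h2 : ∀ t, x₂ t = x₂ τ + ∫ s in τ..t, F s (x₂ s))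
    (ha : ‖x₁ τ - x₂ τ‖ ≤ a) (t : ℝ) :
    ‖x₁ t - x₂ t‖ ≤ 2 * a * Real.cosh (c * (t - τ)) := by
  have hwpos : ∀ s, 0 < Real.cosh (c * (s - τ)) := fun s => Real.cosh_pos _
  obtain ⟨t0, ht0, hmax⟩ := (isCompact_uIcc (a := τ) (b := t)).exists_isMaxOn
    (f := fun s => ‖x₁ s - x₂ s‖ / Real.cosh (c * (s - τ))) Set.nonempty_uIcc
    (by
      apply Continuous.continuousOn
      apply Continuous.div (by fun_prop) (by fun_prop)
      exact fun s => (hwpos s).ne')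
  set m := ‖x₁ t0 - x₂ t0‖ / Real.cosh (c * (t0 - τ)) with hm
  have hm0 : 0 ≤ m := div_nonneg (norm_nonneg _) (hwpos _).le
  have hmle : ∀ s ∈ Set.uIcc τ t, ‖x₁ s - x₂ s‖ ≤ m * Real.cosh (c * (s - τ)) := by
    intro s hs
    have := hmax hs
    simp only [Set.mem_ofPred_eq] at this
    exact (div_le_iff₀ (hwpos s)).1 this
  have hc1 : Continuous fun s => F s (x₁ s) := hF.comp (continuous_id.prodMk hx₁)
  have hc2 : Continuous fun s => F s (x₂ s) := hF.comp (continuous_id.prodMk hx₂)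
  have hk := aux_kernel (E := E) (N := N) (c := c) (D := m) (τ := τ) (t := t0) (r := r)
    (φ := fun _ => 0) (g := fun s => F s (x₁ s) - F s (x₂ s)) hN hc hNc hm0 hr0
    (fun _ => le_rfl) hr (integrable_zero _ _ _) hr4 (by
      intro s hs
      have hs' : s ∈ Set.uIcc τ t :=
        Set.uIcc_subset_uIcc_left ht0 (Set.uIoc_subset_uIcc hs)
      have := hL s (x₁ s) (x₂ s)
      have h3 := mul_le_mul_of_nonneg_left (hmle s hs') (add_nonneg hN (hr0 s))
      linarith)
  rw [intervalIntegral.integral_sub (hc1.intervalIntegrable _ _)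
    (hc2.intervalIntegrable _ _)] at hk
  simp only [integral_zero, add_zero] at hk
  have heq : x₁ t0 - x₂ t0 = (x₁ τ - x₂ τ) +
      ((∫ s in τ..t0, F s (x₁ s)) - ∫ s in τ..t0, F s (x₂ s)) := by
    rw [h1 t0, h2 t0]; abel
  have hn : ‖x₁ t0 - x₂ t0‖ ≤ a + m / 2 * Real.cosh (c * (t0 - τ)) := by
    rw [heq]; exact (norm_add_le _ _).trans (add_le_add ha hk)
  have hmeq : ‖x₁ t0 - x₂ t0‖ = m * Real.cosh (c * (t0 - τ)) := by
    rw [hm]; field_simp [(hwpos t0).ne']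
  have h1c := Real.one_le_cosh (c * (t0 - τ))
  have hm2 : m ≤ 2 * a := by nlinarith
  exact (hmle t Set.right_mem_uIcc).trans
    (mul_le_mul_of_nonneg_right hm2 (hwpos t).le)

theorem aux_exists {E : Type*} [NormedAddCommGroup E] [NormedSpace ℝ E] [CompleteSpace E]
    {N c : ℝ} {r φ : ℝ → ℝ} {F : ℝ → E → E}
    (hN : 0 ≤ N) (hc : 0 < c) (hNc : 4 * N ≤ c)
    (hr0 : ∀ s, 0 ≤ r s) (hr : Integrable r) (hr4 : (∫ s, r s) ≤ 1 / 4)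
    (hφ0 : ∀ s, 0 ≤ φ s) (hφ : Integrable φ)
    (hL : ∀ t x y, ‖F t x - F t y‖ ≤ (N + r t) * ‖x - y‖)
    (hb : ∀ t, ‖F t 0‖ ≤ φ t)
    (hF : Continuous fun p : ℝ × E => F p.1 p.2) (τ : ℝ) (ξ : E) :
    ∃ x : ℝ → E, x τ = ξ ∧ ∀ t, HasDerivAt x (F t (x t)) t := by
  set w : ℝ → ℝ := fun t => Real.cosh (c * (t - τ)) with hw
  have hwc : Continuous w := by rw [hw]; fun_prop
  have hw1 : ∀ t, 1 ≤ w t := fun t => Real.one_le_cosh _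
  have hwpos : ∀ s, 0 < w s := fun s => Real.cosh_pos _
  have hcF : ∀ x : ℝ → E, Continuous x → Continuous fun s => F s (x s) :=
    fun x hx => hF.comp (continuous_id.prodMk hx)
  let S : (ℝ → E) → ℝ → E := fun x t => ξ + ∫ s in τ..t, F s (x s)
  have hSd : ∀ x : ℝ → E, Continuous x → ∀ t, HasDerivAt (S x) (F t (x t)) t := by
    intro x hx t
    exact (((hcF x hx).integral_hasStrictDerivAt τ t).hasDerivAt).const_add ξ
  have hSc : ∀ x : ℝ → E, Continuous x → Continuous (S x) := fun x hx =>
    continuous_iff_continuousAt.2 fun t => (hSd x hx t).continuousAt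
  have hbd : ∀ u : BoundedContinuousFunction ℝ E, ∀ t,
      ‖(w t)⁻¹ • S (fun s => w s • u s) t‖ ≤ ‖ξ‖ + ‖u‖ / 2 + ∫ s, φ s := by
    intro u t
    have hk := aux_kernel (E := E) (N := N) (c := c) (D := ‖u‖) (τ := τ) (t := t) (r := r)
      (φ := φ) (g := fun s => F s (w s • u s)) hN hc hNc (norm_nonneg _) hr0 hφ0 hr hφ hr4 (by
        intro s _
        have e1 := hL s (w s • u s) 0
        have e2 : ‖w s • u s - 0‖ ≤ ‖u‖ * w s := by
          rw [sub_zero, norm_smul, Real.norm_of_nonneg (hwpos s).le, mul_comm]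
          exact mul_le_mul_of_nonneg_right (u.norm_coe_le_norm s) (hwpos s).le
        have e3 := mul_le_mul_of_nonneg_left e2 (add_nonneg hN (hr0 s))
        have e4 := norm_sub_norm_le (F s (w s • u s)) (F s 0)
        have e5 := hb s
        simp only [hw] at *
        linarith)
    have h1 : ‖S (fun s => w s • u s) t‖ ≤ ‖ξ‖ + (‖u‖ / 2 * w t + ∫ s, φ s) :=
      (norm_add_le _ _).trans (add_le_add_right hk _)
    rw [norm_smul, norm_inv, Real.norm_of_nonneg (hwpos t).le, inv_mul_le_iff₀ (hwpos t)]
    have h2 : 0 ≤ ∫ s, φ s := integral_nonneg hφ0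
    have h3 := norm_nonneg ξ
    nlinarith [hw1 t]
  let T : BoundedContinuousFunction ℝ E → BoundedContinuousFunction ℝ E := fun u =>
    BoundedContinuousFunction.ofNormedAddCommGroup
      (fun t => (w t)⁻¹ • S (fun s => w s • u s) t)
      ((hwc.inv₀ fun s => (hwpos s).ne').smul (hSc _ (hwc.smul u.continuous)))
      _ (hbd u)
  have hT : ∀ u t, T u t = (w t)⁻¹ • S (fun s => w s • u s) t := fun u t => rfl
  have hcontr : ContractingWith (1 / 2 : NNReal) T := by
    refine ⟨by
      rw [← NNReal.coe_lt_coe]; push_cast; norm_num, LipschitzWith.of_dist_le_mul ?_⟩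
    intro u v
    rw [BoundedContinuousFunction.dist_le (by positivity)]
    intro t
    have hk := aux_kernel (E := E) (N := N) (c := c) (D := dist u v) (τ := τ) (t := t) (r := r)
      (φ := fun _ => 0) (g := fun s => F s (w s • u s) - F s (w s • v s)) hN hc hNc
      dist_nonneg hr0 (fun _ => le_rfl) hr (integrable_zero _ _ _) hr4 (by
        intro s _
        have e1 := hL s (w s • u s) (w s • v s)
        have e2 : ‖w s • u s - w s • v s‖ ≤ dist u v * w s := by
          rw [← smul_sub, norm_smul, Real.norm_of_nonneg (hwpos s).le, mul_comm, ← dist_eq_norm]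
          exact mul_le_mul_of_nonneg_right (u.dist_coe_le_dist s) (hwpos s).le
        have e3 := mul_le_mul_of_nonneg_left e2 (add_nonneg hN (hr0 s))
        simp only [hw] at *
        linarith)
    rw [intervalIntegral.integral_sub
      ((hcF (fun s => w s • u s) (hwc.smul u.continuous)).intervalIntegrable _ _)
      ((hcF (fun s => w s • v s) (hwc.smul v.continuous)).intervalIntegrable _ _)] at hk
    simp only [integral_zero, add_zero] at hk
    rw [dist_eq_norm, hT, hT, ← smul_sub, norm_smul, norm_inv,
      Real.norm_of_nonneg (hwpos t).le, inv_mul_le_iff₀ (hwpos t)]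
    have e : S (fun s => w s • u s) t - S (fun s => w s • v s) t =
        (∫ s in τ..t, F s (w s • u s)) - ∫ s in τ..t, F s (w s • v s) := by
      simp only [S]; abel
    rw [e]
    push_cast
    simp only [hw] at *
    linarith
  obtain ⟨u, hu⟩ : ∃ u, T u = u := ⟨_, hcontr.fixedPoint_isFixedPt⟩
  have hx : (fun s => w s • u s) = S (fun s => w s • u s) := by
    funext t
    have : u t = (w t)⁻¹ • S (fun s => w s • u s) t := by
      conv_lhs => rw [← hu]
      exact hT u t
    conv_lhs => rw [this]
    rw [smul_smul, mul_inv_cancel₀ (hwpos t).ne', one_smul]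
  refine ⟨fun s => w s • u s, ?_, ?_⟩
  · have := congrFun hx τ
    simp only [S, intervalIntegral.integral_same, add_zero] at this
    exact this
  · intro t
    have := hSd (fun s => w s • u s) (hwc.smul u.continuous) t
    rw [← hx] at this
    exact this

theorem aux_split {ψ : ℝ → ℝ} (hψ : Integrable ψ) :
    ∃ (B : ℝ) (r : ℝ → ℝ), 0 ≤ B ∧ (∀ s, 0 ≤ r s) ∧ Integrable r ∧ (∫ s, r s) ≤ 1 / 4 ∧
      ∀ s, ψ s ≤ B + r s := by
  obtain ⟨g, hg1, hg2, hg3, hg4⟩ := hψ.exists_hasCompactSupport_integral_sub_le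
    (ε := 1 / 4) (by norm_num)
  obtain ⟨B, hB⟩ := hg1.exists_bound_of_continuous hg3
  refine ⟨B, fun s => ‖ψ s - g s‖, (norm_nonneg _).trans (hB 0), fun s => norm_nonneg _,
    (hψ.sub hg4).norm, hg2, fun s => ?_⟩
  have h1 := hB s
  have h2 := le_abs_self (g s)
  have h3 := le_abs_self (ψ s - g s)
  simp only [Real.norm_eq_abs] at *
  linarith

theorem aux_green_bound {n : ℕ} {U Uinv : ℝ → Op n} {P Q : Op n} {β α : ℝ}
    (htri : ExpTrichotomy U Uinv P Q β α) (t s : ℝ) : ‖greenG U Uinv P Q t s‖ ≤ β := by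
  obtain ⟨-, -, -, -, hβ, hα, h1, h2, h3, h4⟩ := htri
  have key : ∀ d, 0 ≤ d → β * Real.exp (-α * d) ≤ β := by
    intro d hd
    have : Real.exp (-α * d) ≤ 1 := Real.exp_le_one_iff.2 (by nlinarith)
    nlinarith
  unfold greenG
  split_ifs with a b b
  · exact (h1 s t a b).trans (key _ (by linarith))
  · rw [norm_neg]; exact (h2 s t (by linarith) a).trans (key _ (by linarith))
  · rw [norm_neg]; exact (h3 s t b (by linarith)).trans (key _ (by linarith))
  · exact (h4 s t (by linarith) (by linarith)).trans (key _ (by linarith))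

theorem aux_green_meas {n : ℕ} {U Uinv : ℝ → Op n} {P Q : Op n}
    (hUi : Continuous Uinv) (t : ℝ) {p : ℝ → Euc n} (hp : Continuous p) :
    AEStronglyMeasurable (fun s => greenG U Uinv P Q t s (p s)) := by
  have hG : StronglyMeasurable (fun s => greenG U Uinv P Q t s) := by
    unfold greenG
    refine StronglyMeasurable.ite measurableSet_Ici
      (StronglyMeasurable.ite measurableSet_Iic ?_ ?_)
      (StronglyMeasurable.ite measurableSet_Ici ?_ ?_) <;>
    · apply Continuous.stronglyMeasurable
      fun_prop
  exact (isBoundedBilinearMap_apply.continuous.comp_stronglyMeasurable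
    (hG.prodMk hp.stronglyMeasurable)).aestronglyMeasurable

theorem aux_Uinv_cont {n : ℕ} {A U Uinv : ℝ → Op n} (h : IsFundamental A U Uinv) :
    Continuous Uinv := by
  obtain ⟨h1, h2, h3⟩ := h
  rw [continuous_iff_continuousAt]
  intro t
  let u : ℝ → (Op n)ˣ := fun t => ⟨U t, Uinv t, h2 t, h3 t⟩
  have e : Uinv = fun t => Ring.inverse (U t) := by
    funext t
    exact (Ring.inverse_unit (u t)).symm
  rw [e]
  exact ContinuousAt.comp (f := U) (g := Ring.inverse)
    (NormedRing.inverse_continuousAt (u t)) (h1 t).continuousAt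

set_option linter.unusedSimpArgs false in
theorem aux_green_pt {n : ℕ} {A U Uinv : ℝ → Op n} {P Q : Op n}
    (h : IsFundamental A U Uinv) (t s : ℝ) (hs0 : s ≠ 0) (hst : s ≠ t) (v : Euc n) :
    greenG U Uinv P Q t s v - U t (Uinv 0 (greenG U Uinv P Q 0 s v)) =
      (Set.Ioc 0 t).indicator (fun s => U t (Uinv s v)) s
      - (Set.Ioc t 0).indicator (fun s => U t (Uinv s v)) s := by
  have hinv : ∀ w, Uinv 0 (U 0 w) = w := fun w => by
    have := congrArg (fun T : Op n => T w) (h.2.2 0)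
    simpa using this
  simp only [greenG, Set.indicator, Set.mem_Ioc]
  rcases lt_or_gt_of_ne hs0 with a | a <;> rcases lt_or_gt_of_ne hst with b | b
  · simp [a.not_ge, b.not_ge, a.not_gt, b.not_gt, a.le, b.le, hinv]
  · simp [a.not_ge, b.not_ge, a.not_gt, b.not_gt, a.le, b.le, a, b, hinv]
    abel
  · simp [a.not_ge, b.not_ge, a.not_gt, b.not_gt, a.le, b.le, a, b, hinv]
  · simp [a.not_ge, b.not_ge, a.not_gt, b.not_gt, a.le, b.le, a, b, hinv]

theorem aux_green_int {n : ℕ} {A U Uinv : ℝ → Op n} {P Q : Op n} {β α : ℝ}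
    (h : IsFundamental A U Uinv) (htri : ExpTrichotomy U Uinv P Q β α)
    {φ : ℝ → ℝ} (hφ : Integrable φ) {p : ℝ → Euc n} (hp : Continuous p)
    (hpb : ∀ s, ‖p s‖ ≤ φ s) (t : ℝ) :
    Integrable (fun s => greenG U Uinv P Q t s (p s)) := by
  refine (hφ.const_mul β).mono' (aux_green_meas (aux_Uinv_cont h) t hp)
    (Filter.Eventually.of_forall fun s => ?_)
  have hβ : 0 ≤ β := by linarith [htri.2.2.2.2.1]
  exact (ContinuousLinearMap.le_opNorm _ _).trans
    (mul_le_mul (aux_green_bound htri t s) (hpb s) (norm_nonneg _) hβ)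

theorem aux_green_deriv {n : ℕ} {A U Uinv : ℝ → Op n} {P Q : Op n} {β α : ℝ}
    (h : IsFundamental A U Uinv) (htri : ExpTrichotomy U Uinv P Q β α)
    {φ : ℝ → ℝ} (hφ : Integrable φ) {p : ℝ → Euc n} (hp : Continuous p)
    (hpb : ∀ s, ‖p s‖ ≤ φ s) (t : ℝ) :
    HasDerivAt (fun t => ∫ s, greenG U Uinv P Q t s (p s))
      (A t (∫ s, greenG U Uinv P Q t s (p s)) + p t) t := by
  have hUi := aux_Uinv_cont h
  have hint := aux_green_int h htri hφ hp hpb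
  have hcU : Continuous fun s => Uinv s (p s) := hUi.clm_apply hp
  have hform : ∀ t, ∫ s, greenG U Uinv P Q t s (p s) =
      U t (Uinv 0 (∫ s, greenG U Uinv P Q 0 s (p s)) + ∫ s in (0:ℝ)..t, Uinv s (p s)) := by
    intro t
    have hcU' : Continuous fun s => U t (Uinv s (p s)) := by fun_prop
    have hi2 : Integrable (fun s => U t (Uinv 0 (greenG U Uinv P Q 0 s (p s)))) :=
      ((U t).comp (Uinv 0)).integrable_comp (hint 0)
    have e1 : ∫ s, (greenG U Uinv P Q t s (p s)
        - U t (Uinv 0 (greenG U Uinv P Q 0 s (p s)))) =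
        ∫ s in (0:ℝ)..t, U t (Uinv s (p s)) := by
      rw [intervalIntegral, ← integral_indicator measurableSet_Ioc,
        ← integral_indicator measurableSet_Ioc, ← integral_sub]
      · apply integral_congr_ae
        have hz : ∀ a : ℝ, ∀ᵐ s : ℝ, s ≠ a := fun a => by
          simp [ae_iff]
        filter_upwards [hz 0, hz t] with s h0 h1
        rw [aux_green_pt h t s h0 h1 (p s)]
        simp only [Set.indicator]
      · rw [integrable_indicator_iff measurableSet_Ioc]
        exact hcU'.integrableOn_Ioc
      · rw [integrable_indicator_iff measurableSet_Ioc]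
        exact hcU'.integrableOn_Ioc
    rw [integral_sub (hint t) hi2] at e1
    have e2 : ∫ s, U t (Uinv 0 (greenG U Uinv P Q 0 s (p s))) =
        U t (Uinv 0 (∫ s, greenG U Uinv P Q 0 s (p s))) :=
      ((U t).comp (Uinv 0)).integral_comp_comm (hint 0)
    have e3 : ∫ s in (0:ℝ)..t, U t (Uinv s (p s)) = U t (∫ s in (0:ℝ)..t, Uinv s (p s)) :=
      (U t).intervalIntegral_comp_comm (hcU.intervalIntegrable _ _)
    rw [e2, e3] at e1
    rw [map_add, ← e1]; abel
  have hd := (h.1 t).clm_apply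
    ((hcU.integral_hasStrictDerivAt 0 t).hasDerivAt.const_add
      (Uinv 0 (∫ s, greenG U Uinv P Q 0 s (p s))))
  have hinv : U t (Uinv t (p t)) = p t := by
    have := congrArg (fun T : Op n => T (p t)) (h.2.1 t)
    simpa using this
  rw [hinv, ContinuousLinearMap.comp_apply, ← hform t] at hd
  rw [funext hform]
  exact hd

theorem aux_fp_exists {E : Type*} [NormedAddCommGroup E] [NormedSpace ℝ E] [CompleteSpace E]
    {G : ℝ → ℝ → E →L[ℝ] E} {β : ℝ} {φ ψ : ℝ → ℝ} {f : ℝ → E → E}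
    (hβ : 0 ≤ β) (hGb : ∀ t s, ‖G t s‖ ≤ β)
    (hGi : ∀ t (p : ℝ → E), Continuous p → (∀ s, ‖p s‖ ≤ φ s) →
      Integrable fun s => G t s (p s))
    (hGc : ∀ p : ℝ → E, Continuous p → (∀ s, ‖p s‖ ≤ φ s) →
      Continuous fun t => ∫ s, G t s (p s))
    (hfc : Continuous fun pr : ℝ × E => f pr.1 pr.2)
    (hφ : Integrable φ) (hψ : Integrable ψ) (hψ0 : ∀ t, 0 ≤ ψ t)
    (hfb : ∀ t x, ‖f t x‖ ≤ φ t)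
    (hflip : ∀ t x₁ x₂, ‖f t x₁ - f t x₂‖ ≤ ψ t * ‖x₁ - x₂‖)
    (hq : β * (∫ s, ψ s) < 1) (y : ℝ → E) (hy : Continuous y) :
    ∃ z : ℝ → E, Continuous z ∧ ∀ t, z t = y t + ∫ s, G t s (f s (z s)) := by
  have hcF : ∀ x : ℝ → E, Continuous x → Continuous fun s => f s (x s) :=
    fun x hx => hfc.comp (continuous_id.prodMk hx)
  have hbd : ∀ (x : ℝ → E) t, ‖∫ s, G t s (f s (x s))‖ ≤ ∫ s, β * φ s := by
    intro x t
    refine norm_integral_le_of_norm_le (hφ.const_mul β) (Filter.Eventually.of_forall fun s => ?_)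
    exact (ContinuousLinearMap.le_opNorm _ _).trans
      (mul_le_mul (hGb t s) (hfb s _) (norm_nonneg _) hβ)
  let T : BoundedContinuousFunction ℝ E → BoundedContinuousFunction ℝ E := fun u =>
    BoundedContinuousFunction.ofNormedAddCommGroup
      (fun t => ∫ s, G t s (f s (y s + u s)))
      (hGc (fun s => f s (y s + u s)) (hcF (fun s => y s + u s) (hy.add u.continuous))
        (fun s => hfb _ _)) _ (hbd _)
  have hT : ∀ u t, T u t = ∫ s, G t s (f s (y s + u s)) := fun u t => rfl
  have hq0 : 0 ≤ β * ∫ s, ψ s := mul_nonneg hβ (integral_nonneg hψ0)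
  have hcontr : ContractingWith (Real.toNNReal (β * ∫ s, ψ s)) T := by
    refine ⟨by rw [← NNReal.coe_lt_coe, Real.coe_toNNReal _ hq0]; exact hq, LipschitzWith.of_dist_le_mul ?_⟩
    intro u v
    rw [Real.coe_toNNReal _ hq0, BoundedContinuousFunction.dist_le (mul_nonneg hq0 dist_nonneg)]
    intro t
    rw [dist_eq_norm, hT, hT, ← integral_sub
      (hGi t (fun s => f s (y s + u s)) (hcF (fun s => y s + u s) (hy.add u.continuous))
        (fun s => hfb _ _))
      (hGi t (fun s => f s (y s + v s)) (hcF (fun s => y s + v s) (hy.add v.continuous))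
        (fun s => hfb _ _))]
    have e : (β * ∫ s, ψ s) * dist u v = ∫ s, β * dist u v * ψ s := by
      rw [integral_const_mul]; ring
    rw [e]
    refine norm_integral_le_of_norm_le (hψ.const_mul _) (Filter.Eventually.of_forall fun s => ?_)
    rw [← map_sub]
    refine (ContinuousLinearMap.le_opNorm _ _).trans ?_
    have h1 := hflip s (y s + u s) (y s + v s)
    rw [add_sub_add_left_eq_sub, ← dist_eq_norm (u s)] at h1
    have h2 := mul_le_mul_of_nonneg_left (u.dist_coe_le_dist (g := v) s) (hψ0 s)
    calc _ ≤ β * (ψ s * dist u v) := mul_le_mul (hGb t s) (h1.trans h2) (norm_nonneg _) hβ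
      _ = _ := by ring
  obtain ⟨u, hu⟩ : ∃ u, T u = u := ⟨_, hcontr.fixedPoint_isFixedPt⟩
  refine ⟨fun t => y t + u t, hy.add u.continuous, fun t => ?_⟩
  rw [← hT u t, hu]

theorem aux_fp_stab {E : Type*} [NormedAddCommGroup E] [NormedSpace ℝ E] [CompleteSpace E]
    {G : ℝ → ℝ → E →L[ℝ] E} {β : ℝ} {φ ψ : ℝ → ℝ} {f : ℝ → E → E}
    (hβ : 0 ≤ β) (hGb : ∀ t s, ‖G t s‖ ≤ β)
    (hGi : ∀ t (p : ℝ → E), Continuous p → (∀ s, ‖p s‖ ≤ φ s) →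
      Integrable fun s => G t s (p s))
    (hfc : Continuous fun pr : ℝ × E => f pr.1 pr.2)
    (hφ : Integrable φ) (hψ : Integrable ψ) (hψ0 : ∀ t, 0 ≤ ψ t)
    (hfb : ∀ t x, ‖f t x‖ ≤ φ t)
    (hflip : ∀ t x₁ x₂, ‖f t x₁ - f t x₂‖ ≤ ψ t * ‖x₁ - x₂‖)
    (hq : β * (∫ s, ψ s) < 1) {y₁ y₂ z₁ z₂ : ℝ → E} (hy₁ : Continuous y₁)
    (hy₂ : Continuous y₂) (hz₁ : Continuous z₁) (hz₂ : Continuous z₂)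
    (h1 : ∀ t, z₁ t = y₁ t + ∫ s, G t s (f s (z₁ s)))
    (h2 : ∀ t, z₂ t = y₂ t + ∫ s, G t s (f s (z₂ s))) (t : ℝ) :
    ‖(z₁ t - y₁ t) - (z₂ t - y₂ t)‖ ≤
      (β * ∫ s, ‖f s (z₁ s) - f s (z₁ s + (y₂ s - y₁ s))‖) / (1 - β * ∫ s, ψ s) := by
  have hcF : ∀ x : ℝ → E, Continuous x → Continuous fun s => f s (x s) :=
    fun x hx => hfc.comp (continuous_id.prodMk hx)
  set ε := β * ∫ s, ‖f s (z₁ s) - f s (z₁ s + (y₂ s - y₁ s))‖ with hε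
  set d : ℝ → ℝ := fun t => ‖(z₁ t - y₁ t) - (z₂ t - y₂ t)‖ with hd
  have hI : Integrable fun s => f s (z₁ s) - f s (z₁ s + (y₂ s - y₁ s)) := by
    refine (hφ.add hφ).mono' ?_ (Filter.Eventually.of_forall fun s => ?_)
    · exact ((hcF z₁ hz₁).sub (hcF (fun s => z₁ s + (y₂ s - y₁ s))
        (hz₁.add (hy₂.sub hy₁)))).aestronglyMeasurable
    · exact (norm_sub_le _ _).trans (add_le_add (hfb _ _) (hfb _ _))
  have hdeq : ∀ t, d t = ‖∫ s, G t s (f s (z₁ s) - f s (z₂ s))‖ := by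
    intro t
    simp only [map_sub]
    rw [integral_sub (hGi t _ (hcF z₁ hz₁) fun s => hfb _ _)
      (hGi t _ (hcF z₂ hz₂) fun s => hfb _ _)]
    have e1 := h1 t
    have e2 := h2 t
    simp only [hd]
    rw [← sub_eq_iff_eq_add'.2 e1, ← sub_eq_iff_eq_add'.2 e2]
  have hbdd : BddAbove (Set.range d) := by
    refine ⟨∫ s, β * (φ s + φ s), ?_⟩
    rintro _ ⟨t, rfl⟩
    rw [hdeq]
    refine norm_integral_le_of_norm_le ((hφ.add hφ).const_mul β)
      (Filter.Eventually.of_forall fun s => ?_)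
    exact (ContinuousLinearMap.le_opNorm _ _).trans
      (mul_le_mul (hGb t s) ((norm_sub_le _ _).trans (add_le_add (hfb _ _) (hfb _ _)))
        (norm_nonneg _) hβ)
  set D := ⨆ t, d t with hD
  have hle : ∀ t, d t ≤ D := fun t => le_ciSup hbdd t
  have hstep : ∀ t, d t ≤ ε + (β * ∫ s, ψ s) * D := by
    intro t
    rw [hdeq]
    have e : ε + (β * ∫ s, ψ s) * D =
        ∫ s, (β * ‖f s (z₁ s) - f s (z₁ s + (y₂ s - y₁ s))‖ + β * D * ψ s) := by
      rw [integral_add (hI.norm.const_mul β) (hψ.const_mul _), integral_const_mul,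
        integral_const_mul]
      ring
    rw [e]
    refine norm_integral_le_of_norm_le ((hI.norm.const_mul β).add (hψ.const_mul _))
      (Filter.Eventually.of_forall fun s => ?_)
    have a1 : ‖f s (z₁ s) - f s (z₂ s)‖ ≤
        ‖f s (z₁ s) - f s (z₁ s + (y₂ s - y₁ s))‖ + ψ s * D := by
      have b1 := norm_sub_le_norm_sub_add_norm_sub (f s (z₁ s))
        (f s (z₁ s + (y₂ s - y₁ s))) (f s (z₂ s))
      have b2 := hflip s (z₁ s + (y₂ s - y₁ s)) (z₂ s)
      have b3 : z₁ s + (y₂ s - y₁ s) - z₂ s = (z₁ s - y₁ s) - (z₂ s - y₂ s) := by abel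
      rw [b3] at b2
      have b4 := mul_le_mul_of_nonneg_left (hle s) (hψ0 s)
      simp only [hd] at b4
      linarith
    calc _ ≤ ‖G t s‖ * ‖f s (z₁ s) - f s (z₂ s)‖ := ContinuousLinearMap.le_opNorm _ _
      _ ≤ β * (‖f s (z₁ s) - f s (z₁ s + (y₂ s - y₁ s))‖ + ψ s * D) :=
        mul_le_mul (hGb t s) a1 (norm_nonneg _) hβ
      _ = _ := by ring
  have hDle : D ≤ ε + (β * ∫ s, ψ s) * D := ciSup_le hstep
  rw [le_div_iff₀ (by linarith)]
  have := hle t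
  simp only [hd] at this
  nlinarith

theorem aux_sol_int {E : Type*} [NormedAddCommGroup E] [NormedSpace ℝ E] [CompleteSpace E]
    {F : ℝ → E → E} (hF : Continuous fun p : ℝ × E => F p.1 p.2) {x : ℝ → E}
    (hx : ∀ t, HasDerivAt x (F t (x t)) t) (τ t : ℝ) :
    x t = x τ + ∫ s in τ..t, F s (x s) := by
  have hc : Continuous x := continuous_iff_continuousAt.2 fun t => (hx t).continuousAt
  have hcF : Continuous fun s => F s (x s) := hF.comp (continuous_id.prodMk hc)
  rw [intervalIntegral.integral_eq_sub_of_hasDerivAt (fun s _ => hx s)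
    (hcF.intervalIntegrable _ _)]
  abel

/-- **Theorem 2.8 (linearization with integrable nonlinearity).**
Suppose the exponential trichotomy of `y' = A(t)y` comes from a decomposition
`P = P₁ + P₂ + P₃`, `Q = P₂ + P₃ + P₄` into mutually orthogonal projections with
`‖U(t)P₁U(s)⁻¹‖ ≤ κ₁` and `‖U(t)P₄U(s)⁻¹‖ ≤ κ₂` for all `t, s`, and `f` satisfies
`|f(t,x)| ≤ φ(t)`, `|f(t,x₁) − f(t,x₂)| ≤ ψ(t)|x₁ − x₂|` with `φ, ψ` integrable,
`∫φ < c₁`, `∫ψ < c₂` and `(β + 2κ₁ + κ₂)c₂ < 1`.  Then the nonlinear system is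
topologically conjugated to the linear one. -/
theorem linearization_integrable_nonlinearity {n : ℕ} (A U Uinv : ℝ → Op n)
    (P Q : Op n) (Ps : Fin 4 → Op n) (β α κ₁ κ₂ c₁ c₂ : ℝ) (φ ψ : ℝ → ℝ)
    (f : ℝ → Euc n → Euc n)
    (hA : Continuous A) (hAbound : ∃ C, ∀ t, ‖A t‖ ≤ C)
    (hfund : IsFundamental A U Uinv)
    (htri : ExpTrichotomy U Uinv P Q β α)
    (hidem : ∀ i, (Ps i).comp (Ps i) = Ps i)
    (horth : ∀ i j, i ≠ j → (Ps i).comp (Ps j) = 0)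
    (hPsum : P = Ps 0 + Ps 1 + Ps 2) (hQsum : Q = Ps 1 + Ps 2 + Ps 3)
    (hκ₁ : ∀ t s : ℝ, ‖(U t).comp ((Ps 0).comp (Uinv s))‖ ≤ κ₁)
    (hκ₂ : ∀ t s : ℝ, ‖(U t).comp ((Ps 3).comp (Uinv s))‖ ≤ κ₂)
    (hfc : Continuous fun pr : ℝ × Euc n => f pr.1 pr.2)
    (hφ0 : ∀ t, 0 ≤ φ t) (hψ0 : ∀ t, 0 ≤ ψ t)
    (hφint : Integrable φ) (hψint : Integrable ψ)
    (hφc : (∫ t, φ t) < c₁) (hψc : (∫ t, ψ t) < c₂)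
    (hfb : ∀ t x, ‖f t x‖ ≤ φ t)
    (hflip : ∀ t x₁ x₂, ‖f t x₁ - f t x₂‖ ≤ ψ t * ‖x₁ - x₂‖)
    (hsmall : (β + 2 * κ₁ + κ₂) * c₂ < 1) :
    ∃ H L : ℝ → Euc n → Euc n, ConjPair A f H L := by

  classical
  obtain ⟨M, hM⟩ := hAbound
  have hM0 : 0 ≤ M := (norm_nonneg _).trans (hM 0)
  obtain ⟨B, r, hB0, hr0, hr, hr4, hψr⟩ := aux_split hψint
  have hβ1 : 1 ≤ β := htri.2.2.2.2.1
  have hβ : 0 ≤ β := by linarith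
  have hUi := aux_Uinv_cont hfund
  have hUc : Continuous U := continuous_iff_continuousAt.2 fun t => (hfund.1 t).continuousAt
  have hUU : ∀ t v, U t (Uinv t v) = v := fun t v => by
    have := congrArg (fun T : Op n => T v) (hfund.2.1 t)
    simpa using this
  have hΨ0 : 0 ≤ ∫ s, ψ s := integral_nonneg hψ0
  have hq : β * (∫ s, ψ s) < 1 := by
    have k1 : 0 ≤ κ₁ := (norm_nonneg _).trans (hκ₁ 0 0)
    have k2 : 0 ≤ κ₂ := (norm_nonneg _).trans (hκ₂ 0 0)
    have : β * (∫ s, ψ s) ≤ (β + 2 * κ₁ + κ₂) * c₂ :=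
      mul_le_mul (by linarith) hψc.le hΨ0 (by linarith)
    linarith
  -- the nonlinear vector field
  let F : ℝ → Euc n → Euc n := fun t x => A t x + f t x
  have hF : Continuous fun p : ℝ × Euc n => F p.1 p.2 := by
    have h1 : Continuous fun p : ℝ × Euc n => A p.1 p.2 :=
      (hA.comp continuous_fst).clm_apply continuous_snd
    exact h1.add hfc
  have hFL : ∀ t x y, ‖F t x - F t y‖ ≤ (M + B + r t) * ‖x - y‖ := by
    intro t x y
    have e : F t x - F t y = A t (x - y) + (f t x - f t y) := by
      simp only [F, map_sub]; abel
    rw [e]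
    have e1 := (A t).le_of_opNorm_le (hM t) (x - y)
    have e2 := hflip t x y
    have e3 := mul_le_mul_of_nonneg_right (hψr t) (norm_nonneg (x - y))
    have e4 := norm_add_le (A t (x - y)) (f t x - f t y)
    nlinarith
  have hN : 0 ≤ M + B := add_nonneg hM0 hB0
  have hc : 0 < 4 * (M + B) + 1 := by linarith
  have hNc : 4 * (M + B) ≤ 4 * (M + B) + 1 := by linarith
  have hF0 : ∀ t, ‖F t 0‖ ≤ φ t := fun t => by simpa [F] using hfb t 0
  have hex := aux_exists hN hc hNc hr0 hr hr4 hφ0 hφint hFL hF0 hF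
  choose X hX0 hXd using hex
  have hcont : ∀ {x : ℝ → Euc n} {x' : ℝ → Euc n}, (∀ t, HasDerivAt x (x' t) t) →
      Continuous x := fun h => continuous_iff_continuousAt.2 fun t => (h t).continuousAt
  have hgron : ∀ {x₁ x₂ : ℝ → Euc n}, IsNonlinSol A f x₁ → IsNonlinSol A f x₂ → ∀ τ t,
      ‖x₁ t - x₂ t‖ ≤ 2 * ‖x₁ τ - x₂ τ‖ * Real.cosh ((4 * (M + B) + 1) * (t - τ)) := by
    intro x₁ x₂ h1 h2 τ t
    exact aux_gronwall hN hc hNc hr0 hr hr4 hFL hF (hcont h1) (hcont h2)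
      (aux_sol_int hF h1 τ) (aux_sol_int hF h2 τ) le_rfl t
  have huniq : ∀ {x₁ x₂ : ℝ → Euc n}, IsNonlinSol A f x₁ → IsNonlinSol A f x₂ → ∀ τ,
      x₁ τ = x₂ τ → x₁ = x₂ := by
    intro x₁ x₂ h1 h2 τ h
    funext t
    have := hgron h1 h2 τ t
    rw [h, sub_self, norm_zero, mul_zero, zero_mul] at this
    exact sub_eq_zero.1 (norm_le_zero_iff.1 this)
  -- linear solutions
  let lin : ℝ → Euc n → ℝ → Euc n := fun τ v s => U s (Uinv τ v)
  have hlin : ∀ τ v, IsLinSol A (lin τ v) := by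
    intro τ v t
    have := (hfund.1 t).clm_apply (hasDerivAt_const t (Uinv τ v))
    simpa [lin] using this
  have hlinτ : ∀ τ v, lin τ v τ = v := fun τ v => hUU τ v
  have hlinu : ∀ {y₁ y₂ : ℝ → Euc n}, IsLinSol A y₁ → IsLinSol A y₂ → ∀ τ,
      y₁ τ = y₂ τ → y₁ = y₂ := by
    intro y₁ y₂ h1 h2 τ h
    funext t
    have hFA : Continuous fun p : ℝ × Euc n => A p.1 p.2 :=
      (hA.comp continuous_fst).clm_apply continuous_snd
    have := aux_gronwall (F := fun t x => A t x) (r := fun _ => 0) (N := M) (c := 4 * M + 1)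
      hM0 (by linarith) (by linarith) (fun _ => le_rfl) (integrable_zero _ _ _) (by simp)
      (by
        intro t x y
        rw [← map_sub, add_zero]
        exact (A t).le_of_opNorm_le (hM t) (x - y)) hFA (hcont h1) (hcont h2)
      (aux_sol_int hFA h1 τ) (aux_sol_int hFA h2 τ) le_rfl t
    rw [h, sub_self, norm_zero, mul_zero, zero_mul] at this
    exact sub_eq_zero.1 (norm_le_zero_iff.1 this)
  -- the Green function
  let G := greenG U Uinv P Q
  have hGb : ∀ t s, ‖G t s‖ ≤ β := aux_green_bound htri
  have hGi : ∀ t (p : ℝ → Euc n), Continuous p → (∀ s, ‖p s‖ ≤ φ s) →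
      Integrable fun s => G t s (p s) := fun t p hp hpb =>
    aux_green_int hfund htri hφint hp hpb t
  have hGd : ∀ (p : ℝ → Euc n), Continuous p → (∀ s, ‖p s‖ ≤ φ s) → ∀ t,
      HasDerivAt (fun t => ∫ s, G t s (p s)) (A t (∫ s, G t s (p s)) + p t) t :=
    fun p hp hpb t => aux_green_deriv hfund htri hφint hp hpb t
  have hGc : ∀ p : ℝ → Euc n, Continuous p → (∀ s, ‖p s‖ ≤ φ s) →
      Continuous fun t => ∫ s, G t s (p s) := fun p hp hpb => hcont (hGd p hp hpb)
  have hcf : ∀ x : ℝ → Euc n, Continuous x → Continuous fun s => f s (x s) :=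
    fun x hx => hfc.comp (continuous_id.prodMk hx)
  have hIb : ∀ (x : ℝ → Euc n) t, ‖∫ s, G t s (f s (x s))‖ ≤ ∫ s, β * φ s := by
    intro x t
    refine norm_integral_le_of_norm_le (hφint.const_mul β)
      (Filter.Eventually.of_forall fun s => ?_)
    exact (ContinuousLinearMap.le_opNorm _ _).trans
      (mul_le_mul (hGb t s) (hfb s _) (norm_nonneg _) hβ)
  have hfp := fun τ v => aux_fp_exists hβ hGb hGi hGc hfc hφint hψint hψ0 hfb hflip hq
    (lin τ v) (hcont (hlin τ v))
  choose Z hZc hZ using hfp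
  have hstab := fun {y₁ y₂ z₁ z₂ : ℝ → Euc n} =>
    aux_fp_stab (y₁ := y₁) (y₂ := y₂) (z₁ := z₁) (z₂ := z₂)
      hβ hGb hGi hfc hφint hψint hψ0 hfb hflip hq
  have hfpu : ∀ {y z₁ z₂ : ℝ → Euc n}, Continuous y → Continuous z₁ → Continuous z₂ →
      (∀ t, z₁ t = y t + ∫ s, G t s (f s (z₁ s))) →
      (∀ t, z₂ t = y t + ∫ s, G t s (f s (z₂ s))) → z₁ = z₂ := by
    intro y z₁ z₂ hy h1 h2 e1 e2
    funext t
    have := hstab hy hy h1 h2 e1 e2 t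
    simp only [sub_self, add_zero, norm_zero, integral_zero, mul_zero, zero_div] at this
    have := norm_le_zero_iff.1 this
    rw [sub_sub_sub_cancel_right] at this
    exact sub_eq_zero.1 this
  -- nonlinear to linear
  have hNL : ∀ x, IsNonlinSol A f x →
      IsLinSol A (fun t => x t - ∫ s, G t s (f s (x s))) := by
    intro x hx t
    have := (hx t).sub (hGd _ (hcf x (hcont hx)) (fun s => hfb _ _) t)
    refine HasDerivAt.congr_deriv (f := fun t => x t - ∫ s, G t s (f s (x s))) this ?_
    rw [map_sub]; abel
  -- linear to nonlinear
  have hLN : ∀ y z : ℝ → Euc n, IsLinSol A y → Continuous z →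
      (∀ t, z t = y t + ∫ s, G t s (f s (z s))) → IsNonlinSol A f z := by
    intro y z hy hz e t
    have := (hy t).add (hGd _ (hcf z hz) (fun s => hfb _ _) t)
    have e' : z = fun t => y t + ∫ s, G t s (f s (z s)) := funext e
    have h2 : HasDerivAt (fun t => y t + ∫ s, G t s (f s (z s)))
      (A t (y t) + (A t (∫ s, G t s (f s (z s))) + f t (z t))) t := this
    rw [← e'] at h2
    refine h2.congr_deriv ?_
    rw [← add_assoc, ← map_add, ← e t]
  have hZsol : ∀ τ v, IsNonlinSol A f (Z τ v) := fun τ v =>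
    hLN _ _ (hlin τ v) (hZc τ v) (hZ τ v)
  refine ⟨fun t x => x - ∫ s, G t s (f s (X t x s)), fun t y => Z t y t,
    ?_, ?_, ?_, ?_, ?_, ?_, ?_, ?_⟩
  · intro t
    refine continuous_id.sub ?_
    refine continuous_of_dominated (bound := fun s => β * φ s) (fun x => ?_) (fun x => ?_)
      (hφint.const_mul β) (Filter.Eventually.of_forall fun s => ?_)
    · exact (hGi t _ (hcf _ (hcont (hXd t x))) fun s => hfb _ _).aestronglyMeasurable
    · refine Filter.Eventually.of_forall fun s => ?_
      exact (ContinuousLinearMap.le_opNorm _ _).trans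
        (mul_le_mul (hGb t s) (hfb s _) (norm_nonneg _) hβ)
    · refine (G t s).continuous.comp ?_
      have hXc : Continuous fun x => X t x s := by
        have : LipschitzWith (Real.toNNReal (2 * Real.cosh ((4 * (M + B) + 1) * (s - t))))
            fun x => X t x s := by
          refine LipschitzWith.of_dist_le_mul fun x y => ?_
          rw [Real.coe_toNNReal _ (by positivity), dist_eq_norm, dist_eq_norm]
          have := hgron (hXd t x) (hXd t y) t s
          rw [hX0, hX0] at this
          linarith
        exact this.continuous
      exact hfc.comp (continuous_const.prodMk hXc)
  · intro t
    rw [continuous_iff_continuousAt]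
    intro y0
    have hK : Continuous fun y => ∫ s, ‖f s (Z t y0 s) -
        f s (Z t y0 s + (lin t y s - lin t y0 s))‖ := by
      refine continuous_of_dominated (bound := fun s => φ s + φ s) (fun y => ?_) (fun y => ?_)
        (hφint.add hφint) (Filter.Eventually.of_forall fun s => ?_)
      · exact (((hcf _ (hZc t y0)).sub (hcf (fun s => Z t y0 s + (lin t y s - lin t y0 s))
          ((hZc t y0).add ((hcont (hlin t y)).sub (hcont (hlin t y0)))))).norm).aestronglyMeasurable
      · refine Filter.Eventually.of_forall fun s => ?_
        rw [norm_norm]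
        exact (norm_sub_le _ _).trans (add_le_add (hfb _ _) (hfb _ _))
      · refine (continuous_const.sub (hfc.comp (continuous_const.prodMk ?_))).norm
        have : Continuous fun y => lin t y s := by
          simp only [lin]; fun_prop
        exact continuous_const.add (this.sub continuous_const)
    have hK2 : Continuous fun y => ‖y0 - y‖ + (β * ∫ s, ‖f s (Z t y0 s) -
        f s (Z t y0 s + (lin t y s - lin t y0 s))‖) / (1 - β * ∫ s, ψ s) :=
      (continuous_const.sub continuous_id).norm.add ((continuous_const.mul hK).div_const _)
    have hlim := hK2.tendsto y0
    simp only [sub_self, add_zero, norm_zero, integral_zero, mul_zero, zero_div] at hlim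
    rw [ContinuousAt, tendsto_iff_norm_sub_tendsto_zero]
    refine squeeze_zero (fun _ => norm_nonneg _) (fun y => ?_) hlim
    have h1 := hstab (hcont (hlin t y0)) (hcont (hlin t y)) (hZc t y0) (hZc t y)
      (hZ t y0) (hZ t y) t
    have e : Z t y t - Z t y0 t =
        -((y0 - y) + ((Z t y0 t - lin t y0 t) - (Z t y t - lin t y t))) := by
      rw [hlinτ, hlinτ]; abel
    rw [e, norm_neg]
    exact (norm_add_le _ _).trans (add_le_add_right h1 _)
  · intro t x
    have h1 := hNL _ (hXd t x)
    have h2 := hlinu h1 (hlin t (x - ∫ s, G t s (f s (X t x s)))) t (by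
      simp only [hX0, hlinτ])
    have h3 : Z t (x - ∫ s, G t s (f s (X t x s))) = X t x := by
      refine hfpu (hcont (hlin t (x - ∫ s, G t s (f s (X t x s))))) (hZc _ _)
        (hcont (hXd t x)) (hZ _ _) fun s => ?_
      rw [← h2]; simp
    simp only [h3, hX0]
  · intro t y
    have h1 : X t (Z t y t) = Z t y := huniq (hXd _ _) (hZsol t y) t (hX0 _ _)
    simp only [h1]
    have h2 := hZ t y t
    rw [hlinτ] at h2
    exact sub_eq_iff_eq_add.2 h2
  · refine ⟨∫ s, β * φ s, fun t x => ?_⟩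
    simp only [sub_sub_cancel_left, norm_neg]
    exact hIb _ t
  · refine ⟨∫ s, β * φ s, fun t y => ?_⟩
    have h2 := hZ t y t
    rw [hlinτ] at h2
    have h3 : Z t y t - y = ∫ s, G t s (f s (Z t y s)) := sub_eq_iff_eq_add'.2 h2
    simp only [h3]
    exact hIb _ t
  · intro x hx
    have h1 : ∀ t, X t (x t) = x := fun t => huniq (hXd _ _) hx t (hX0 _ _)
    simp only [h1]
    exact hNL x hx
  · intro y hy
    have h1 : ∀ t, lin t (y t) = y := fun t => hlinu (hlin _ _) hy t (hlinτ _ _)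
    have h2 : ∀ t, Z t (y t) = Z 0 (y 0) := by
      intro t
      have a := hZ t (y t)
      have b := hZ 0 (y 0)
      rw [h1] at a b
      exact hfpu (hcont hy) (hZc _ _) (hZc _ _) a b
    simp only [h2]
    exact hZsol 0 (y 0)
end
end
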